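/- arXiv:1907.11303 — 2 statements merged into one kernel-verified Lean document; each statement's English description precedes it below -/
import Mathlib

section
/- Let n ≥ 5. There exist ε₀ > 0 and a constant C > 0 depending only on n and ε₀ such that for every p on the critical hyperbola with |p − 1| ≤ ε₀ and q = q(p), and for every pair (φ, ψ) of C² functions on ℝⁿ satisfying −Δφ = p V_p^{p−1} ψ and −Δψ = q U_p^{q−1} φ on ℝⁿ, with φ(x), ψ(x) → 0 as |x| → ∞ and ‖Δφ‖_{L²(ℝⁿ)} = 1, one has sup_{ℝⁿ} |φ| + sup_{ℝⁿ} |Δφ| ≤ C. -/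
open Filter MeasureTheory Topology

noncomputable def lap {n : ℕ} (f : EuclideanSpace ℝ (Fin n) → ℝ)
    (x : EuclideanSpace ℝ (Fin n)) : ℝ :=
  ∑ i, fderiv ℝ (fderiv ℝ f) x (EuclideanSpace.single i 1) (EuclideanSpace.single i 1)

def IsGroundState (n : ℕ) (p q : ℝ) (U V : EuclideanSpace ℝ (Fin n) → ℝ) : Prop :=
  ContDiff ℝ 2 U ∧ ContDiff ℝ 2 V ∧
  (∀ x, 0 < U x) ∧ (∀ x, 0 < V x) ∧
  (∀ x, -lap U x = V x ^ p) ∧ (∀ x, -lap V x = U x ^ q) ∧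
  (∀ x y, ‖x‖ ≤ ‖y‖ → U y ≤ U x) ∧
  (∀ x y, ‖x‖ ≤ ‖y‖ → V y ≤ V x) ∧
  Tendsto U (cocompact _) (nhds 0) ∧
  Tendsto V (cocompact _) (nhds 0) ∧
  U 0 = 1

namespace LE

section kernel
variable {n : ℕ}

local notation "𝔼" => EuclideanSpace ℝ (Fin n)

/-- The kernel `(1 - |z|^2)_+^2`. -/
noncomputable def bP (z : EuclideanSpace ℝ (Fin n)) : ℝ := (max 0 (1 - ‖z‖ ^ 2)) ^ 2

/-- The kernel `4 (1 - |z|^2)_+`. -/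
noncomputable def bR (z : EuclideanSpace ℝ (Fin n)) : ℝ := 4 * max 0 (1 - ‖z‖ ^ 2)

lemma hasDerivAt_maxsq (s : ℝ) :
    HasDerivAt (fun t : ℝ => (max 0 t) ^ 2) (2 * max 0 s) s := by
  rw [hasDerivAt_iff_isLittleO]
  have h1 : (fun t : ℝ => (max 0 t) ^ 2 - (max 0 s) ^ 2 - (t - s) • (2 * max 0 s)) =O[𝓝 s]
      (fun t : ℝ => (t - s) ^ 2) := by
    refine Asymptotics.IsBigO.of_bound 1 (Eventually.of_forall fun t => ?_)
    rw [one_mul, Real.norm_eq_abs, Real.norm_eq_abs, abs_le, smul_eq_mul,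
      abs_of_nonneg (sq_nonneg (t - s))]
    rcases le_total 0 t with ht | ht <;> rcases le_total 0 s with hs | hs <;>
      simp only [ht, hs, max_eq_left, max_eq_right] <;> constructor <;> 
      nlinarith [sq_nonneg (t - s), sq_nonneg t, sq_nonneg s]
  refine h1.trans_isLittleO ?_
  have h2 : (fun t : ℝ => (t - s)) =o[𝓝 s] (fun _ => (1 : ℝ)) := by
    rw [Asymptotics.isLittleO_one_iff]
    have : Tendsto (fun t : ℝ => t - s) (𝓝 s) (𝓝 (s - s)) := by
      exact (continuous_id.sub continuous_const).tendsto s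
    simpa using this
  have h3 := (Asymptotics.isBigO_refl (fun t : ℝ => t - s) (𝓝 s)).mul_isLittleO h2
  simpa [sq] using h3

lemma bP_hasFDerivAt (z : 𝔼) : HasFDerivAt (bP (n := n)) (-(bR z) • innerSL ℝ z) z := by
  have h1 : HasFDerivAt (fun z : 𝔼 => 1 - ‖z‖ ^ 2) (-((2 : ℝ) • innerSL ℝ z)) z := by
    have := (hasStrictFDerivAt_norm_sq z).hasFDerivAt.const_sub 1
    refine this.congr_fderiv ?_
    ext v
    simp
  have h2 := (hasDerivAt_maxsq (1 - ‖z‖ ^ 2)).comp_hasFDerivAt z h1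
  refine h2.congr_fderiv ?_
  ext v
  simp [bR]
  ring

lemma bP_continuous : Continuous (bP (n := n)) := by unfold bP; fun_prop
lemma bR_continuous : Continuous (bR (n := n)) := by unfold bR; fun_prop
lemma bP_nonneg (z : 𝔼) : 0 ≤ bP z := by unfold bP; positivity
lemma bR_nonneg (z : 𝔼) : 0 ≤ bR z := by
  unfold bR; exact mul_nonneg (by norm_num) (le_max_left _ _)
lemma bR_zero {z : 𝔼} (h : 1 ≤ ‖z‖) : bR z = 0 := by
  unfold bR; rw [max_eq_left (by nlinarith)]; simp
lemma bP_zero {z : 𝔼} (h : 1 ≤ ‖z‖) : bP z = 0 := by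
  unfold bP; rw [max_eq_left (by nlinarith)]; simp

lemma hcs_of {f : 𝔼 → ℝ} (h : ∀ z, 1 ≤ ‖z‖ → f z = 0) : HasCompactSupport f := by
  refine HasCompactSupport.intro (isCompact_closedBall (0 : 𝔼) 1) (fun x hx => h x ?_)
  simp at hx
  exact hx.le

lemma integ_of {f : 𝔼 → ℝ} (hc : Continuous f) (h : ∀ z, 1 ≤ ‖z‖ → f z = 0) :
    Integrable f volume := hc.integrable_of_hasCompactSupport (hcs_of h)

lemma integ_bR {f : 𝔼 → ℝ} (hc : Continuous f) : Integrable (fun z => bR z * f z) volume :=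
  integ_of (bR_continuous.mul hc) (fun z hz => by simp [bR_zero hz])

lemma integ_bP {f : 𝔼 → ℝ} (hc : Continuous f) : Integrable (fun z => bP z * f z) volume :=
  integ_of (bP_continuous.mul hc) (fun z hz => by simp [bP_zero hz])

lemma fderiv_diff {g : 𝔼 → ℝ} (hg : ContDiff ℝ 2 g) : ContDiff ℝ 1 (fderiv ℝ g) :=
  hg.fderiv_right (by norm_num)

lemma lap_continuous {g : 𝔼 → ℝ} (hg : ContDiff ℝ 2 g) : Continuous (lap g) := by
  unfold lap
  have h := ((fderiv_diff hg).continuous_fderiv (by norm_num))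
  fun_prop

/-- The radial mean. -/
noncomputable def Mn (g : 𝔼 → ℝ) (x : 𝔼) (t : ℝ) : ℝ := ∫ z, bR z * g (x + t • z)

lemma ibp {g : 𝔼 → ℝ} (hg : ContDiff ℝ 2 g) (x : 𝔼) (t : ℝ) :
    ∫ z, bR z * fderiv ℝ g (x + t • z) z = t * ∫ z, bP z * lap g (x + t • z) := by
  have hd := (fderiv_diff hg)
  have hdc : Continuous (fderiv ℝ g) := hd.continuous
  have hddc : Continuous (fderiv ℝ (fderiv ℝ g)) := hd.continuous_fderiv (by norm_num)
  have hz : ∀ z : 𝔼, z = ∑ i, z i • EuclideanSpace.single i (1 : ℝ) := by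
    intro z
    ext j
    simp [Finset.sum_apply, Pi.single_apply]
  have key : ∀ i : Fin n, ∫ z, bR z * (z i * fderiv ℝ g (x + t • z) (EuclideanSpace.single i 1))
      = ∫ z, bP z * (t * fderiv ℝ (fderiv ℝ g) (x + t • z) (EuclideanSpace.single i 1)
        (EuclideanSpace.single i 1)) := by
    intro i
    set e : 𝔼 := EuclideanSpace.single i 1 with he
    have hG : ∀ z : 𝔼, HasFDerivAt (fun z : 𝔼 => fderiv ℝ g (x + t • z) e)
        (t • (ContinuousLinearMap.apply ℝ ℝ e).comp (fderiv ℝ (fderiv ℝ g) (x + t • z))) z := by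
      intro z
      have h1 : HasFDerivAt (fun z : 𝔼 => x + t • z) (t • ContinuousLinearMap.id ℝ 𝔼) z :=
        ((hasFDerivAt_id z).const_smul t).const_add x
      have h2 : HasFDerivAt (fderiv ℝ g) (fderiv ℝ (fderiv ℝ g) (x + t • z)) (x + t • z) :=
        (hd.differentiable (by norm_num) _).hasFDerivAt
      have h3 := (ContinuousLinearMap.apply ℝ ℝ e).hasFDerivAt.comp z (h2.comp z h1)
      refine h3.congr_fderiv ?_
      ext v
      simp
    have := integral_bilinear_hasFDerivAt_right_eq_neg_left_of_integrable (μ := volume)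
      (f := bP (n := n)) (f' := fun z => (-(bR z) • innerSL ℝ z))
      (g := fun z : 𝔼 => fderiv ℝ g (x + t • z) e)
      (g' := fun z => t • (ContinuousLinearMap.apply ℝ ℝ e).comp (fderiv ℝ (fderiv ℝ g) (x + t • z)))
      (v := e) (B := ContinuousLinearMap.mul ℝ ℝ) ?_ ?_ ?_ (fun z _ => bP_hasFDerivAt z) (fun z _ => hG z)
    · simp only [ContinuousLinearMap.mul_apply', smul_apply, 
        ContinuousLinearMap.comp_apply, ContinuousLinearMap.apply_apply, smul_eq_mul] at this
      rw [this, ← integral_neg]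
      congr 1
      ext z
      simp [he, EuclideanSpace.inner_single_right]
      ring
    · refine integ_of ?_ ?_
      · have := bR_continuous (n := n)
        simp only [ContinuousLinearMap.mul_apply', smul_apply, smul_eq_mul, innerSL_apply_apply]
        fun_prop
      · intro z hz
        simp [bR_zero hz]
    · refine integ_of ?_ ?_
      · have := bP_continuous (n := n)
        simp only [ContinuousLinearMap.mul_apply', smul_apply, 
          ContinuousLinearMap.comp_apply, ContinuousLinearMap.apply_apply, smul_eq_mul]
        fun_prop
      · intro z hz
        simp [bP_zero hz]
    · refine integ_of ?_ ?_
      · have := bP_continuous (n := n)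
        simp only [ContinuousLinearMap.mul_apply']
        fun_prop
      · intro z hz
        simp [bP_zero hz]
  have e1 : ∀ z : 𝔼, bR z * fderiv ℝ g (x + t • z) z =
      ∑ i, bR z * (z i * fderiv ℝ g (x + t • z) (EuclideanSpace.single i 1)) := by
    intro z
    conv_lhs => rw [show fderiv ℝ g (x + t • z) z = fderiv ℝ g (x + t • z)
      (∑ i, z i • EuclideanSpace.single i (1 : ℝ)) by rw [← hz z]]
    rw [map_sum, Finset.mul_sum]
    simp
  have e2 : ∀ z : 𝔼, t * (bP z * lap g (x + t • z)) =
      ∑ i, bP z * (t * fderiv ℝ (fderiv ℝ g) (x + t • z) (EuclideanSpace.single i 1)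
        (EuclideanSpace.single i 1)) := by
    intro z
    simp only [lap, Finset.mul_sum]
    refine Finset.sum_congr rfl fun i _ => by ring
  rw [← integral_const_mul]
  simp_rw [e1, e2]
  rw [integral_finsetSum, integral_finsetSum]
  · exact Finset.sum_congr rfl fun i _ => key i
  · intro i _
    exact integ_bP (by fun_prop)
  · intro i _
    exact integ_bR (by fun_prop)

lemma Mn_hasDerivAt {g : 𝔼 → ℝ} (hg : ContDiff ℝ 2 g) (x : 𝔼) (t : ℝ) :
    HasDerivAt (Mn g x) (t * ∫ z, bP z * lap g (x + t • z)) t := by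
  have hgc := hg.continuous
  have hdc : Continuous (fderiv ℝ g) := (fderiv_diff hg).continuous
  have hRc := bR_continuous (n := n)
  rw [← ibp hg]
  -- bound on compact
  obtain ⟨B, hB⟩ := (isCompact_closedBall x (|t| + 1)).exists_bound_of_continuousOn
    (f := fderiv ℝ g) hdc.continuousOn
  have hB0 : 0 ≤ B := (norm_nonneg _).trans (hB x (by simp; positivity))
  refine (hasDerivAt_integral_of_dominated_loc_of_deriv_le (μ := volume)
    (F := fun s z => bR z * g (x + s • z)) (F' := fun s z => bR z * fderiv ℝ g (x + s • z) z)
    (x₀ := t) (bound := fun z : 𝔼 => bR z * B) (Metric.ball_mem_nhds t one_pos) ?_ ?_ ?_ ?_ ?_ ?_).2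
  · refine Eventually.of_forall fun s => ?_
    exact (integ_bR (by fun_prop)).aestronglyMeasurable
  · exact integ_bR (by fun_prop)
  · exact (integ_bR (by fun_prop)).aestronglyMeasurable
  · refine Eventually.of_forall fun z s hs => ?_
    rcases le_or_gt 1 ‖z‖ with hz | hz
    · simp [bR_zero hz]
    · rw [norm_mul, Real.norm_of_nonneg (bR_nonneg z)]
      refine mul_le_mul_of_nonneg_left ?_ (bR_nonneg z)
      have h1 := (fderiv ℝ g (x + s • z)).le_opNorm z
      have h2 := hB (x + s • z) (by
        rw [mem_closedBall_iff_norm]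
        simp only [add_sub_cancel_left, norm_smul, Real.norm_eq_abs]
        rw [Metric.mem_ball, Real.dist_eq] at hs
        have : |s| ≤ |t| + 1 := by
          have := abs_sub_abs_le_abs_sub s t
          linarith
        nlinarith [norm_nonneg z, abs_nonneg s])
      nlinarith [norm_nonneg z]
  · exact integ_bR continuous_const
  · refine Eventually.of_forall fun z s hs => ?_
    have h1 : HasDerivAt (fun s : ℝ => x + s • z) z s := by
      simpa using ((hasDerivAt_id s).smul_const z).const_add x
    have h2 := ((hg.differentiable (by norm_num) (x + s • z)).hasFDerivAt).comp_hasDerivAt s h1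
    exact h2.const_mul (bR z)

lemma Mn_zero (g : 𝔼 → ℝ) (x : 𝔼) : Mn g x 0 = (∫ z : 𝔼, bR z) * g x := by
  simp [Mn, integral_mul_const]

lemma bR_int_pos : 0 < ∫ z : 𝔼, bR z := by
  refine bR_continuous.integral_pos_of_hasCompactSupport_nonneg_nonzero
    (hcs_of fun z hz => bR_zero hz) (fun z => bR_nonneg z) (x := 0) ?_
  simp [bR]

lemma bP_int_nonneg : 0 ≤ ∫ z : 𝔼, bP z := integral_nonneg fun z => bP_nonneg z

lemma Mn_local {g : 𝔼 → ℝ} (hg : ContDiff ℝ 2 g) (x : 𝔼) {r K : ℝ} (hr : 0 ≤ r)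
    (hK : ∀ w : 𝔼, ‖w‖ ≤ r → |lap g (x + w)| ≤ K) :
    |Mn g x r - Mn g x 0| ≤ K * (∫ z : 𝔼, bP z) * r ^ 2 / 2 := by
  have hlc := lap_continuous hg
  have h := image_norm_le_of_norm_deriv_right_le_deriv_boundary'
    (f := fun t => Mn g x t - Mn g x 0) (a := 0) (b := r)
    (f' := fun t => t * ∫ z, bP z * lap g (x + t • z))
    (B := fun t => K * (∫ z : 𝔼, bP z) * t ^ 2 / 2)
    (B' := fun t => K * (∫ z : 𝔼, bP z) * t)
    ?_ ?_ ?_ ?_ ?_ ?_ (Set.right_mem_Icc.2 hr)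
  · simpa using h
  · intro t _
    exact ((Mn_hasDerivAt hg x t).sub_const _).continuousAt.continuousWithinAt
  · intro t _
    exact ((Mn_hasDerivAt hg x t).sub_const _).hasDerivWithinAt
  · simp
  · fun_prop
  · intro t _
    refine HasDerivAt.hasDerivWithinAt ?_
    have := (((hasDerivAt_id t).pow 2).const_mul (K * (∫ z : 𝔼, bP z))).div_const 2
    refine this.congr_deriv ?_
    simp
    ring
  · intro t ht
    rw [norm_mul, Real.norm_of_nonneg ht.1, mul_comm]
    refine mul_le_mul_of_nonneg_right ?_ ht.1
    rw [← integral_const_mul]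
    refine norm_integral_le_of_norm_le ((integ_bP (f := fun _ => 1) continuous_const).const_mul K |>.congr ?_) ?_
    · exact Eventually.of_forall fun z => by simp
    · refine Eventually.of_forall fun z => ?_
      rcases le_or_gt 1 ‖z‖ with hz | hz
      · simp [bP_zero hz]
      · rw [norm_mul, Real.norm_of_nonneg (bP_nonneg z), mul_comm]
        refine mul_le_mul_of_nonneg_right (hK _ ?_) (bP_nonneg z)
        rw [norm_smul, Real.norm_of_nonneg ht.1]
        nlinarith [norm_nonneg z, ht.1, ht.2]

lemma Mn_super {g : 𝔼 → ℝ} (hg : ContDiff ℝ 2 g) (x : 𝔼) {r : ℝ} (hr : 0 ≤ r)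
    (hK : ∀ w, lap g w ≤ 0) :
    Mn g x r ≤ (∫ z : 𝔼, bR z) * g x := by
  rw [← Mn_zero]
  have : AntitoneOn (Mn g x) (Set.Ici 0) := by
    refine antitoneOn_of_deriv_nonpos (convex_Ici 0)
      (fun t _ => (Mn_hasDerivAt hg x t).continuousAt.continuousWithinAt)
      (fun t _ => (Mn_hasDerivAt hg x t).differentiableAt.differentiableWithinAt) ?_
    intro t ht
    rw [interior_Ici] at ht
    rw [(Mn_hasDerivAt hg x t).deriv]
    refine mul_nonpos_of_nonneg_of_nonpos (le_of_lt ht) (integral_nonpos fun z => ?_)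
    exact mul_nonpos_of_nonneg_of_nonpos (bP_nonneg z) (hK _)
  exact this Set.self_mem_Ici hr hr

lemma L2_bound {f k : 𝔼 → ℝ} (hf : Continuous f) (hL : eLpNorm f 2 volume = 1)
    (hk : Continuous k) (hks : ∀ z, 1 ≤ ‖z‖ → k z = 0) (x : 𝔼) {t : ℝ} (ht : 0 < t) :
    ∫ z, k z * |f (x + t • z)| ≤ t ^ (-(n : ℝ) / 2) * (((∫ z, k z ^ 2) + 1) / 2) := by
  have hm : MemLp f 2 volume := ⟨hf.aestronglyMeasurable, by simp [hL]⟩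
  have hi : Integrable (fun z => f z ^ 2) volume := hm.integrable_sq
  have hI : ∫ z, f z ^ 2 = 1 := by
    have h := hm.eLpNorm_eq_integral_rpow_norm (by norm_num) (by norm_num)
    rw [hL] at h
    have h2 := congrArg ENNReal.toReal h
    rw [ENNReal.toReal_ofReal (by positivity)] at h2
    simp only [ENNReal.toReal_one, ENNReal.toReal_ofNat, Real.rpow_ofNat, Real.norm_eq_abs, sq_abs] at h2
    have h3 : 0 ≤ ∫ z, f z ^ 2 := integral_nonneg fun z => sq_nonneg _
    have h4 := congrArg (· ^ (2 : ℝ)) h2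
    simp only [Real.one_rpow] at h4
    rw [← Real.rpow_mul h3] at h4
    norm_num at h4
    exact h4.symm
  have hi2 : Integrable (fun z => f (x + t • z) ^ 2) volume :=
    (hi.comp_add_left x).comp_smul ht.ne'
  have hI2 : ∫ z, f (x + t • z) ^ 2 = t ^ (-(n : ℝ)) := by
    have := Measure.integral_comp_smul (μ := (volume : Measure 𝔼)) (fun z => f (x + z) ^ 2) t
    rw [this, integral_add_left_eq_self (fun z => f z ^ 2) x, hI]
    simp only [finrank_euclideanSpace, Fintype.card_fin, smul_eq_mul, mul_one]
    rw [abs_of_nonneg (by positivity), Real.rpow_neg ht.le, Real.rpow_natCast]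
  set l := t ^ (-(n : ℝ) / 2) with hl
  have hlpos : 0 < l := Real.rpow_pos_of_pos ht _
  have hl2 : t ^ (-(n : ℝ)) = l * l := by
    rw [hl, ← Real.rpow_add ht]; congr 1; ring
  have hk2 : Integrable (fun z => k z ^ 2) volume :=
    integ_of (hk.pow 2) (fun z hz => by simp [hks z hz])
  calc ∫ z, k z * |f (x + t • z)| ≤ ∫ z, (l / 2 * k z ^ 2 + (1 / (2 * l)) * f (x + t • z) ^ 2) := by
        refine integral_mono (integ_of (by fun_prop) (fun z hz => by simp [hks z hz]))
          ((hk2.const_mul _).add (hi2.const_mul _)) (fun z => ?_)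
        show k z * |f (x + t • z)| ≤ l / 2 * k z ^ 2 + (1 / (2 * l)) * f (x + t • z) ^ 2
        rw [← sq_abs (f _)]
        set F := |f (x + t • z)|
        have : l / 2 * k z ^ 2 + 1 / (2 * l) * F ^ 2 - k z * F = (l * k z - F) ^ 2 / (2 * l) := by
          field_simp; ring
        have h2 : 0 ≤ (l * k z - F) ^ 2 / (2 * l) := by positivity
        linarith
    _ = l / 2 * (∫ z, k z ^ 2) + 1 / (2 * l) * (l * l) := by
        rw [integral_add (hk2.const_mul _) (hi2.const_mul _), integral_const_mul, integral_const_mul, hI2, hl2]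
    _ = _ := by field_simp

lemma Mn_tendsto (hn : 5 ≤ n) {g : 𝔼 → ℝ} (hg : Continuous g) (h0 : Tendsto g (cocompact _) (𝓝 0)) (x : 𝔼) :
    Tendsto (Mn g x) atTop (𝓝 0) := by
  have : NeZero n := ⟨by omega⟩
  obtain ⟨B, hB⟩ : ∃ B, ∀ y, ‖g y‖ ≤ B := by
    let gz : ZeroAtInftyContinuousMap 𝔼 ℝ := ⟨⟨g, hg⟩, h0⟩
    obtain ⟨B, hB⟩ := isBounded_iff_forall_norm_le.1 gz.isBounded_range
    exact ⟨B, fun y => hB _ ⟨y, rfl⟩⟩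
  have key := tendsto_integral_filter_of_dominated_convergence (μ := (volume : Measure 𝔼))
    (l := atTop) (F := fun (t : ℝ) z => bR z * g (x + t • z)) (f := fun _ => 0)
    (fun z => bR z * B) ?_ ?_ ?_ ?_
  · simp only [integral_zero] at key
    exact key
  · exact Eventually.of_forall fun t => (integ_bR (by fun_prop)).aestronglyMeasurable
  · refine Eventually.of_forall fun t => Eventually.of_forall fun z => ?_
    rw [norm_mul, Real.norm_of_nonneg (bR_nonneg z)]
    exact mul_le_mul_of_nonneg_left (hB _) (bR_nonneg z)
  · exact integ_bR continuous_const
  · have h1 : ∀ᵐ z : 𝔼, z ≠ 0 := by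
      rw [ae_iff]; simp
    filter_upwards [h1] with z hz
    rw [show (0 : ℝ) = bR z * 0 by simp]
    refine Tendsto.const_mul _ (h0.comp ?_)
    rw [← Metric.cobounded_eq_cocompact, ← comap_norm_atTop, tendsto_comap_iff]
    refine tendsto_atTop_mono (f := fun t : ℝ => t * ‖z‖ - ‖x‖) (fun t => ?_) ?_
    · have h2 : ‖t • z‖ ≤ ‖x + t • z‖ + ‖x‖ := by
        have := norm_sub_le (x + t • z) x
        simpa using this
      rw [norm_smul] at h2
      have h3 := mul_le_mul_of_nonneg_right (le_abs_self t) (norm_nonneg z)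
      simp only [Function.comp]
      rw [Real.norm_eq_abs] at h2
      linarith
    · exact tendsto_atTop_add_const_right _ _ (tendsto_id.atTop_mul_const (norm_pos_iff.2 hz))

lemma Mn_far (hn : 5 ≤ n) {g : 𝔼 → ℝ} (hg : ContDiff ℝ 2 g) (h0 : Tendsto g (cocompact _) (𝓝 0))
    (hL : eLpNorm (fun x => lap g x) 2 volume = 1) (x : 𝔼) {r : ℝ} (hr : 0 < r) :
    |Mn g x r| ≤ (((∫ z : 𝔼, bP z ^ 2) + 1) / 2) * (r ^ (2 - (n : ℝ) / 2) / ((n : ℝ) / 2 - 2)) := by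
  have hlc := lap_continuous hg
  set D := (((∫ z : 𝔼, bP z ^ 2) + 1) / 2) with hD
  have hD0 : 0 ≤ D := by
    have : 0 ≤ ∫ z : 𝔼, bP z ^ 2 := integral_nonneg fun z => sq_nonneg _
    positivity
  have hn' : (5 : ℝ) ≤ n := by exact_mod_cast hn
  set m : ℝ := (n : ℝ) / 2 - 2 with hm
  have hm0 : 0 < m := by rw [hm]; linarith
  have hR : ∀ R, r ≤ R → |Mn g x R - Mn g x r| ≤ D * (r ^ (-m) / m) := by
    intro R hR
    have h := image_norm_le_of_norm_deriv_right_le_deriv_boundary'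
      (f := fun t => Mn g x t - Mn g x r) (a := r) (b := R)
      (f' := fun t => t * ∫ z, bP z * lap g (x + t • z))
      (B := fun t => D * (r ^ (-m) / m) - D * (t ^ (-m) / m))
      (B' := fun t => D * t ^ (-m - 1))
      ?_ ?_ ?_ ?_ ?_ ?_ (Set.right_mem_Icc.2 hR)
    · have h2 : 0 ≤ D * (R ^ (-m) / m) := by
        have := Real.rpow_nonneg (hr.le.trans hR) (-m)
        positivity
      rw [Real.norm_eq_abs] at h
      linarith
    · intro t _
      exact ((Mn_hasDerivAt hg x t).sub_const _).continuousAt.continuousWithinAt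
    · intro t _
      exact ((Mn_hasDerivAt hg x t).sub_const _).hasDerivWithinAt
    · simp
    · refine ContinuousOn.sub continuousOn_const (continuousOn_const.mul (ContinuousOn.div_const ?_ _))
      intro t ht
      exact (Real.continuousAt_rpow_const t (-m) (Or.inl (hr.trans_le ht.1).ne')).continuousWithinAt
    · intro t ht
      refine HasDerivAt.hasDerivWithinAt ?_
      have := (((Real.hasDerivAt_rpow_const (p := -m) (Or.inl (hr.trans_le ht.1).ne')).div_const m).const_mul D).const_sub
        (D * (r ^ (-m) / m))
      refine this.congr_deriv ?_
      field_simp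
    · intro t ht
      have ht0 : 0 < t := hr.trans_le ht.1
      rw [norm_mul, Real.norm_of_nonneg ht0.le]
      have h1 := L2_bound hlc hL bP_continuous (fun z hz => bP_zero hz) x ht0
      have h2 : ‖∫ z, bP z * lap g (x + t • z)‖ ≤ ∫ z, bP z * |lap g (x + t • z)| := by
        refine (norm_integral_le_integral_norm _).trans_eq ?_
        congr 1; ext z
        rw [norm_mul, Real.norm_of_nonneg (bP_nonneg z), Real.norm_eq_abs]
      have h3 := mul_le_mul_of_nonneg_left (h2.trans h1) ht0.le
      refine h3.trans_eq ?_
      rw [← hD, show -m - 1 = 1 + -(n : ℝ) / 2 by rw [hm]; ring, Real.rpow_add ht0, Real.rpow_one]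
      ring
  have h1 : Tendsto (fun R => |Mn g x R - Mn g x r|) atTop (𝓝 |0 - Mn g x r|) :=
    ((Mn_tendsto hn hg.continuous h0 x).sub_const _).abs
  have h2 := le_of_tendsto h1 ((eventually_ge_atTop r).mono hR)
  rw [zero_sub, abs_neg] at h2
  rwa [show 2 - (n : ℝ) / 2 = -m by rw [hm]; ring]

end kernel

section maxprinciple
variable {n : ℕ}

local notation "𝔼" => EuclideanSpace ℝ (Fin n)

lemma lap_nonpos_of_isLocalMax {g : 𝔼 → ℝ} (hg : ContDiff ℝ 2 g) {x : 𝔼} (hx : IsLocalMax g x) :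
    lap g x ≤ 0 := by
  unfold lap
  refine Finset.sum_nonpos fun i _ => ?_
  set e : 𝔼 := EuclideanSpace.single i 1
  by_contra hcon
  push Not at hcon
  have hl : ∀ t : ℝ, HasDerivAt (fun t : ℝ => x + t • e) e t := fun t => by
    simpa using ((hasDerivAt_id t).smul_const e).const_add x
  have h1 : ∀ t : ℝ, HasDerivAt (fun t : ℝ => g (x + t • e)) (fderiv ℝ g (x + t • e) e) t := fun t =>
    ((hg.differentiable (by norm_num) (x + t • e)).hasFDerivAt).comp_hasDerivAt t (hl t)
  have hd1 : deriv (fun t : ℝ => g (x + t • e)) = fun t => fderiv ℝ g (x + t • e) e :=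
    funext fun t => (h1 t).deriv
  have h2 : HasDerivAt (fun t : ℝ => fderiv ℝ g (x + t • e) e)
      (fderiv ℝ (fderiv ℝ g) (x + (0 : ℝ) • e) e e) 0 := by
    have h3 : HasDerivAt (fun t : ℝ => fderiv ℝ g (x + t • e))
      (fderiv ℝ (fderiv ℝ g) (x + (0 : ℝ) • e) e) 0 :=
      ((((fderiv_diff hg).differentiable (by norm_num) (x + (0 : ℝ) • e)).hasFDerivAt)).comp_hasDerivAt 0 (hl 0)
    have := (ContinuousLinearMap.apply ℝ ℝ e).hasFDerivAt.comp_hasDerivAt (0 : ℝ) h3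
    exact this
  have hd2 : deriv (deriv (fun t : ℝ => g (x + t • e))) 0 = fderiv ℝ (fderiv ℝ g) x e e := by
    rw [hd1, h2.deriv]; simp
  have hmax : IsLocalMax (fun t : ℝ => g (x + t • e)) 0 := by
    have hc : Tendsto (fun t : ℝ => x + t • e) (𝓝 0) (𝓝 x) := by
      have := (hl 0).continuousAt.tendsto
      simpa using this
    have := hc.eventually hx
    simpa [IsLocalMax, IsMaxFilter] using this
  have hmin := isLocalMin_of_deriv_deriv_pos (f := fun t : ℝ => g (x + t • e)) (x₀ := 0)
    (by rw [hd2]; exact hcon) hmax.deriv_eq_zero (h1 0).continuousAt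
  have hconst : (fun t : ℝ => g (x + t • e)) =ᶠ[𝓝 0] fun _ => g (x + (0 : ℝ) • e) := by
    filter_upwards [hmax, hmin] with t ha hb
    exact le_antisymm ha hb
  have := hconst.deriv.deriv_eq
  rw [hd2] at this
  simp at this
  linarith

lemma lap_comb {f g : 𝔼 → ℝ} (hf : ContDiff ℝ 2 f) (hg : ContDiff ℝ 2 g) (a b : ℝ) (x : 𝔼) :
    lap (fun y => a * f y + b * g y) x = a * lap f x + b * lap g x := by
  have h1 : fderiv ℝ (fun y => a * f y + b * g y) = fun y => a • fderiv ℝ f y + b • fderiv ℝ g y := by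
    ext1 y
    exact (((hf.differentiable (by norm_num) y).hasFDerivAt.const_mul a).add
      ((hg.differentiable (by norm_num) y).hasFDerivAt.const_mul b)).fderiv
  have h2 : fderiv ℝ (fun y => a • fderiv ℝ f y + b • fderiv ℝ g y) x =
      a • fderiv ℝ (fderiv ℝ f) x + b • fderiv ℝ (fderiv ℝ g) x := by
    exact ((((fderiv_diff hf).differentiable (by norm_num) x).hasFDerivAt.const_smul a).add
      (((fderiv_diff hg).differentiable (by norm_num) x).hasFDerivAt.const_smul b)).fderiv
  unfold lap
  rw [h1, h2, Finset.mul_sum, Finset.mul_sum, ← Finset.sum_add_distrib]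
  simp

lemma lap_normsq (x : 𝔼) : lap (fun y : 𝔼 => ‖y‖ ^ 2) x = 2 * n := by
  have h1 : fderiv ℝ (fun y : 𝔼 => ‖y‖ ^ 2) = fun y => ((2 : ℝ) • innerSL ℝ (E := 𝔼)) y := by
    ext1 y
    rw [(hasStrictFDerivAt_norm_sq y).hasFDerivAt.fderiv]
    ext v
    simp
  unfold lap
  rw [h1]
  have h2 : fderiv ℝ (fun y => ((2 : ℝ) • innerSL ℝ (E := 𝔼)) y) x = ((2 : ℝ) • innerSL ℝ (E := 𝔼)) :=
    ContinuousLinearMap.fderiv _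
  rw [h2]
  have h3 : ∀ i : Fin n, (((2 : ℝ) • innerSL ℝ (E := 𝔼)) (EuclideanSpace.single i 1))
      (EuclideanSpace.single i 1) = 2 := by
    intro i
    show (2 : ℝ) * inner ℝ (EuclideanSpace.single i (1 : ℝ)) (EuclideanSpace.single i (1 : ℝ)) = 2
    simp
  rw [Finset.sum_congr rfl fun i _ => h3 i]
  simp
  ring

lemma contDiff_normsq : ContDiff ℝ 2 (fun y : 𝔼 => ‖y‖ ^ 2) := contDiff_norm_sq ℝ

lemma ball_max {w : 𝔼 → ℝ} (hw : ContDiff ℝ 2 w) (hl : ∀ x, ‖x‖ < 1 → 0 < lap w x) :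
    ∃ b, ‖b‖ = 1 ∧ w 0 ≤ w b := by
  obtain ⟨b, hb, hmax⟩ := (isCompact_closedBall (0 : 𝔼) 1).exists_isMaxOn ⟨0, by simp⟩
    hw.continuous.continuousOn
  have hb' : ‖b‖ ≤ 1 := by simpa using hb
  refine ⟨b, ?_, hmax (by simp)⟩
  by_contra hne
  have hlt : ‖b‖ < 1 := lt_of_le_of_ne hb' hne
  have hloc : IsLocalMax w b := hmax.isLocalMax (by
    refine Filter.mem_of_superset (Metric.isOpen_ball.mem_nhds (x := b) (by simpa using hlt)) Metric.ball_subset_closedBall)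
  exact absurd (lap_nonpos_of_isLocalMax hw hloc) (not_le.2 (hl b hlt))

lemma harnack_far (n : ℕ) : ∃ H : ℝ, 1 ≤ H ∧ ∀ V : EuclideanSpace ℝ (Fin n) → ℝ, ContDiff ℝ 2 V →
    (∀ x, 0 < V x) → (∀ x y, ‖x‖ ≤ ‖y‖ → V y ≤ V x) → (∀ x, lap V x ≤ 0) →
    ∀ x y, 2 ≤ ‖y‖ → ‖y‖ - 1 ≤ ‖x‖ → V x ≤ H * V y := by
  set β := (volume : Measure (EuclideanSpace ℝ (Fin n))).real (Metric.ball 0 (1 / 8)) with hβ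
  have hβ0 : 0 < β := by
    rw [hβ, measureReal_def]
    exact ENNReal.toReal_pos (Metric.measure_ball_pos _ _ (by norm_num)).ne' measure_ball_lt_top.ne
  set c := ∫ z : EuclideanSpace ℝ (Fin n), bR z with hc
  refine ⟨max 1 (c / (2 * β)), le_max_left _ _, ?_⟩
  intro V hV hpos hrad hlap x y hy hxy
  have hVc := hV.continuous
  have h1 := Mn_super hV y (r := 4) (by norm_num) hlap
  set a : EuclideanSpace ℝ (Fin n) := -((1 / 2) * ‖y‖⁻¹) • y with ha
  have hy0 : 0 < ‖y‖ := by linarith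
  have hna : ‖a‖ = 1 / 2 := by
    rw [ha, norm_smul, norm_neg, Real.norm_of_nonneg (by positivity)]
    field_simp
  have hya : ‖y + (4 : ℝ) • a‖ = ‖y‖ - 2 := by
    have : y + (4 : ℝ) • a = (1 - 2 * ‖y‖⁻¹) • y := by
      rw [ha]; module
    rw [this, norm_smul, Real.norm_of_nonneg]
    · field_simp
    · have : ‖y‖⁻¹ ≤ 2⁻¹ := inv_anti₀ (by norm_num) hy
      linarith
  have h2 : 2 * V x * β ≤ Mn V y 4 := by
    have h3 : ∫ z, (Metric.ball a (1 / 8)).indicator (fun _ => 2 * V x) z = 2 * V x * β := by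
      rw [integral_indicator_const _ Metric.isOpen_ball.measurableSet, smul_eq_mul, hβ, mul_comm,
        measureReal_def, measureReal_def, Measure.addHaar_ball_center]
    rw [← h3]
    refine integral_mono ?_ (integ_bR (by fun_prop)) (fun z => ?_)
    · refine (integrable_indicator_iff Metric.isOpen_ball.measurableSet).2 ?_
      exact integrableOn_const measure_ball_lt_top.ne
    · by_cases hz : z ∈ Metric.ball a (1 / 8)
      · rw [Set.indicator_of_mem hz]
        rw [mem_ball_iff_norm] at hz
        have hz1 : ‖z‖ ≤ 5 / 8 := by
          have := norm_add_le a (z - a)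
          rw [add_sub_cancel] at this
          linarith
        have hz2 : ‖y + (4 : ℝ) • z‖ ≤ ‖x‖ := by
          have h4 : y + (4 : ℝ) • z = (y + (4 : ℝ) • a) + (4 : ℝ) • (z - a) := by module
          have h5 := norm_add_le (y + (4 : ℝ) • a) ((4 : ℝ) • (z - a))
          rw [← h4, hya, norm_smul] at h5
          norm_num at h5
          linarith
        have h6 := hrad _ _ hz2
        have h7 : 2 ≤ bR z := by
          unfold bR
          have := le_max_right 0 (1 - ‖z‖ ^ 2)
          nlinarith [norm_nonneg z]
        show 2 * V x ≤ bR z * V (y + (4 : ℝ) • z)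
        have := hpos x
        exact mul_le_mul h7 h6 this.le (by linarith)
      · rw [Set.indicator_of_notMem hz]
        exact mul_nonneg (bR_nonneg z) (hpos _).le
  have h3 : V x ≤ c / (2 * β) * V y := by
    rw [div_mul_eq_mul_div, le_div_iff₀ (by positivity)]
    linarith
  exact h3.trans (mul_le_mul_of_nonneg_right (le_max_right _ _) (hpos y).le)

end maxprinciple

section params

lemma params {n : ℕ} (hn : 5 ≤ n) {p q : ℝ} (hp : 0 < p) (hq : 0 < q)
    (h : 1 / (p + 1) + 1 / (q + 1) = ((n : ℝ) - 2) / n) (he : |p - 1| ≤ 1 / (10 * n)) :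
    9 / 10 ≤ p ∧ p ≤ 11 / 10 ∧ q ≤ 11 ∧ 1 < q ∧ p ≤ q ∧ q + 1 ≤ 6 * (p + 1) ∧
      (1 - p) * (q + 1) ≤ (q - 1) * (p + 1) := by
  have hn' : (5 : ℝ) ≤ n := by exact_mod_cast hn
  obtain ⟨d, hd⟩ : ∃ d : ℝ, d = 1 / (n : ℝ) := ⟨_, rfl⟩
  have hd0 : 0 < d := by rw [hd]; positivity
  have hd5 : d ≤ 1 / 5 := by rw [hd]; exact one_div_le_one_div_of_le (by norm_num) hn'
  have e1 : ((n : ℝ) - 2) / n = 1 - 2 * d := by rw [hd]; field_simp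
  have e2 : 1 / (10 * (n : ℝ)) = d / 10 := by rw [hd]; field_simp
  rw [e1] at h
  rw [e2, abs_le] at he
  obtain ⟨he1, he2⟩ := he
  have hp1 : 9 / 10 ≤ p := by linarith
  have hp2 : p ≤ 11 / 10 := by linarith
  obtain ⟨s, hs⟩ : ∃ s : ℝ, s = 1 / (q + 1) := ⟨_, rfl⟩
  obtain ⟨r, hr⟩ : ∃ r : ℝ, r = 1 / (p + 1) := ⟨_, rfl⟩
  have hsq : s * (q + 1) = 1 := by rw [hs]; field_simp
  have hrp : r * (p + 1) = 1 := by rw [hr]; field_simp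
  rw [← hs, ← hr] at h
  have hr0 : 0 < r := by rw [hr]; positivity
  have hs0 : 0 < s := by rw [hs]; positivity
  -- r = 1/2 - (p-1) r / 2
  have hr1 : r ≤ 1 / 2 + d / 20 := by nlinarith
  have hr2 : 1 / 2 - d / 20 ≤ r := by nlinarith
  have hs1 : 9 / 100 ≤ s := by linarith
  have hs2 : s ≤ 1 / 2 - 39 / 20 * d := by linarith
  have hq11 : q + 1 ≤ 100 / 9 := by nlinarith
  have hq1 : 1 + 39 / 5 * d ≤ q := by nlinarith
  refine ⟨hp1, hp2, by linarith, by linarith, by linarith, by linarith, ?_⟩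
  have h1 : (1 - p) * (q + 1) ≤ d / 10 * (100 / 9) := by
    have : (1 - p) * (q + 1) ≤ d / 10 * (q + 1) := mul_le_mul_of_nonneg_right (by linarith) (by linarith)
    nlinarith
  nlinarith

lemma ratio_pow {a b H s : ℝ} (ha : 0 < a) (hb : 0 < b) (hH : 1 ≤ H) (h1 : a ≤ H * b) (h2 : b ≤ H * a)
    (hs : |s| ≤ 1) : a ^ s ≤ H * b ^ s := by
  obtain ⟨hs1, hs2⟩ := abs_le.1 hs
  have hH0 : 0 < H := by linarith
  rcases le_total 0 s with h | h
  · calc a ^ s ≤ (H * b) ^ s := Real.rpow_le_rpow ha.le h1 h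
      _ = H ^ s * b ^ s := Real.mul_rpow hH0.le hb.le
      _ ≤ H * b ^ s := by
        refine mul_le_mul_of_nonneg_right ?_ (Real.rpow_nonneg hb.le _)
        simpa using Real.rpow_le_rpow_of_exponent_le hH hs2
  · calc a ^ s ≤ (b / H) ^ s := Real.rpow_le_rpow_of_nonpos (by positivity) (by
          rw [div_le_iff₀ hH0]; linarith) h
      _ = H ^ (-s) * b ^ s := by
        rw [Real.div_rpow hb.le hH0.le, Real.rpow_neg hH0.le]; field_simp
      _ ≤ H * b ^ s := by
        refine mul_le_mul_of_nonneg_right ?_ (Real.rpow_nonneg hb.le _)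
        simpa using Real.rpow_le_rpow_of_exponent_le hH (show -s ≤ 1 by linarith)

end params

section gs
variable {n : ℕ} {p q : ℝ} {U V : EuclideanSpace ℝ (Fin n) → ℝ}

local notation "𝔼" => EuclideanSpace ℝ (Fin n)

lemma gs_U_le_one (h : IsGroundState n p q U V) (x : 𝔼) : U x ≤ 1 := by
  obtain ⟨hU, hV, hU0, hV0, eU, eV, rU, rV, tU, tV, hU1⟩ := h
  rw [← hU1]; exact rU _ _ (by simp)

lemma souplet (hp : 0 < p) (hpq : p ≤ q) (h6 : q + 1 ≤ 6 * (p + 1))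
    (h : IsGroundState n p q U V) (x : 𝔼) : U x ^ (q + 1) ≤ 6 * V x ^ (p + 1) := by
  obtain ⟨hU, hV, hU0, hV0, eU, eV, rU, rV, tU, tV, hU1⟩ := h
  have hUc := hU.continuous
  have hVc := hV.continuous
  have hq : 0 < q := by linarith
  obtain ⟨σ, hσ⟩ : ∃ σ, σ = (p + 1) / (q + 1) := ⟨_, rfl⟩
  have hσ0 : 0 < σ := by rw [hσ]; positivity
  have hσ1 : σ ≤ 1 := by rw [hσ, div_le_one (by linarith)]; linarith
  have hσq : σ * (q + 1) = p + 1 := by rw [hσ]; field_simp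
  have hσ6 : 1 ≤ 6 * σ := by rw [hσ, ← mul_div_assoc, le_div_iff₀ (by linarith)]; linarith
  obtain ⟨l, hl⟩ : ∃ l : ℝ, l = 6 ^ (1 / (q + 1)) := ⟨_, rfl⟩
  have hl0 : 0 < l := by rw [hl]; positivity
  have hlq : l ^ (q + 1) = 6 := by
    rw [hl, ← Real.rpow_mul (by norm_num)]
    rw [one_div_mul_cancel (by linarith)]; simp
  have main : U x ≤ l * V x ^ σ := by
    by_contra hcon
    push Not at hcon
    have hwc : Continuous fun y => U y - l * V y ^ σ := by
      have := hVc.rpow_const (p := σ) (fun y => Or.inl (hV0 y).ne')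
      fun_prop
    have ht : Tendsto (fun y => U y - l * V y ^ σ) (cocompact _) (𝓝 0) := by
      have h1 : Tendsto (fun y => V y ^ σ) (cocompact _) (𝓝 0) := by
        have := tV.rpow_const (p := σ) (Or.inr hσ0.le)
        rwa [Real.zero_rpow hσ0.ne'] at this
      simpa using tU.sub (h1.const_mul l)
    obtain ⟨x0, hx0⟩ := hwc.exists_forall_ge' x
      ((ht.eventually (gt_mem_nhds (sub_pos.2 hcon))).mono fun y hy => le_of_lt hy)
    have hx0' : 0 < U x0 - l * V x0 ^ σ := lt_of_lt_of_le (sub_pos.2 hcon) (hx0 x)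
    set c := l * σ * V x0 ^ (σ - 1) with hc
    have hv := hV0 x0
    have htan : ∀ y, V y ^ σ ≤ V x0 ^ σ + σ * V x0 ^ (σ - 1) * (V y - V x0) := by
      intro y
      have h1 := rpow_one_add_le_one_add_mul_self (s := V y / V x0 - 1) (p := σ)
        (by have : 0 < V y / V x0 := div_pos (hV0 y) hv
            linarith) hσ0.le hσ1
      rw [add_sub_cancel, Real.div_rpow (hV0 y).le hv.le] at h1
      have h2 : 0 < V x0 ^ σ := Real.rpow_pos_of_pos hv _
      rw [div_le_iff₀ h2] at h1
      refine h1.trans_eq ?_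
      rw [Real.rpow_sub_one hv.ne']
      field_simp
    have hmax : IsLocalMax (fun y => 1 * U y + (-c) * V y) x0 := by
      refine Eventually.of_forall fun y => ?_
      have h1 := hx0 y
      have h2 := mul_le_mul_of_nonneg_left (htan y) hl0.le
      simp only [hc]
      nlinarith
    have hlap := lap_nonpos_of_isLocalMax
      (((contDiff_const.mul hU).add (contDiff_const.mul hV))) hmax
    rw [lap_comb hU hV] at hlap
    have e1 := eU x0
    have e2 := eV x0
    have h3 : c * U x0 ^ q ≤ V x0 ^ p := by rw [← e1, ← e2]; linarith
    have h4 : (l * V x0 ^ σ) ^ q < U x0 ^ q :=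
      Real.rpow_lt_rpow (by positivity) (by linarith) hq
    have hc0 : 0 < c := by rw [hc]; positivity
    have h5 : c * (l * V x0 ^ σ) ^ q = 6 * σ * V x0 ^ p := by
      rw [hc, Real.mul_rpow hl0.le (by positivity), ← Real.rpow_mul hv.le]
      have h6 : V x0 ^ p = V x0 ^ (σ - 1) * V x0 ^ (σ * q) := by
        rw [← Real.rpow_add hv]; congr 1; linarith
      have h7 : (6 : ℝ) = l * l ^ q := by
        rw [← hlq, Real.rpow_add hl0, Real.rpow_one]; ring
      rw [h6, h7]; ring
    have h8 := mul_lt_mul_of_pos_left h4 hc0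
    have h9 : 0 < V x0 ^ p := Real.rpow_pos_of_pos hv _
    nlinarith
  have hv := hV0 x
  calc U x ^ (q + 1) ≤ (l * V x ^ σ) ^ (q + 1) := Real.rpow_le_rpow (hU0 x).le main (by linarith)
    _ = _ := by
      rw [Real.mul_rpow hl0.le (by positivity), hlq, ← Real.rpow_mul hv.le, hσq]

lemma gs_bounds (hn : 5 ≤ n) (hp : 9 / 10 ≤ p) (hpq : p ≤ q) (h6 : q + 1 ≤ 6 * (p + 1))
    (h : IsGroundState n p q U V) : 
    V 0 ≤ 4 * (n : ℝ) ^ 2 + 1 ∧ ∀ x, ‖x‖ ≤ 1 → 1 / 20 ≤ V x := by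
  have hS := souplet (by linarith) hpq h6 h 0
  have hU1' := gs_U_le_one h
  obtain ⟨hU, hV, hU0, hV0, eU, eV, rU, rV, tU, tV, hU1⟩ := h
  have hn' : (5 : ℝ) ≤ n := by exact_mod_cast hn
  have hd : 1 / (n : ℝ) ≤ 1 / 5 := one_div_le_one_div_of_le (by norm_num) hn'
  have hV0' : 1 / 6 ≤ V 0 := by
    by_contra hcon
    push Not at hcon
    rw [hU1, Real.one_rpow] at hS
    have := Real.rpow_le_rpow_of_exponent_ge (hV0 0) (by linarith) (show 1 ≤ p + 1 by linarith)
    rw [Real.rpow_one] at this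
    linarith
  -- V + a |x|^2 subharmonic
  obtain ⟨b, hb1, hb⟩ := ball_max (w := fun y => 1 * V y + (11 / (20 * (n : ℝ))) * ‖y‖ ^ 2)
    ((contDiff_const.mul hV).add (contDiff_const.mul contDiff_normsq)) (by
      intro x _
      rw [lap_comb hV contDiff_normsq, lap_normsq]
      have h1 : U x ^ q ≤ 1 := Real.rpow_le_one (hU0 x).le (hU1' x) (by linarith)
      have h2 := eV x
      have h3 : 11 / (20 * (n : ℝ)) * (2 * n) = 11 / 10 := by field_simp; norm_num
      rw [h3]
      linarith)
  simp only [norm_zero, hb1] at hb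
  have hb' : V 0 ≤ V b + 11 / 100 := by
    have : 11 / (20 * (n : ℝ)) = 11 / 20 * (1 / n) := by field_simp
    rw [this] at hb
    norm_num at hb hd
    linarith
  have hlow : ∀ x, ‖x‖ ≤ 1 → V b ≤ V x := fun x hx => rV _ _ (by rw [hb1]; exact hx)
  refine ⟨?_, fun x hx => by linarith [hlow x hx]⟩
  have hVb : V b ≤ 4 * (n : ℝ) ^ 2 := by
    by_contra hcon
    push Not at hcon
    have hVb1 : 1 ≤ V b := by nlinarith
    have hVp : 2 * (n : ℝ) < V b ^ p := by
      have h1 : V b ^ (1 / 2 : ℝ) ≤ V b ^ p := Real.rpow_le_rpow_of_exponent_le hVb1 (by linarith)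
      rw [← Real.sqrt_eq_rpow] at h1
      refine lt_of_lt_of_le ?_ h1
      rw [Real.lt_sqrt (by positivity)]
      linarith
    obtain ⟨b2, hb21, hb2⟩ := ball_max (w := fun y => (-1) * U y + (-1) * ‖y‖ ^ 2)
      ((contDiff_const.mul hU).add (contDiff_const.mul contDiff_normsq)) (by
        intro x hx
        rw [lap_comb hU contDiff_normsq, lap_normsq]
        have h2 := eU x
        have h3 : V b ^ p ≤ V x ^ p := Real.rpow_le_rpow (hV0 b).le (hlow x hx.le) (by linarith)
        linarith)
    simp only [norm_zero, hb21, hU1] at hb2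
    have := hU0 b2
    norm_num at hb2
    linarith
  linarith

lemma gs_UV (hn : 5 ≤ n) (hp : 9 / 10 ≤ p) (hp2 : p ≤ 11 / 10) (hpq : p ≤ q) (hq : 1 < q)
    (h6 : q + 1 ≤ 6 * (p + 1)) (hex : (1 - p) * (q + 1) ≤ (q - 1) * (p + 1))
    (h : IsGroundState n p q U V) (x : 𝔼) : V x ^ (p - 1) * U x ^ (q - 1) ≤ 4 * (n : ℝ) ^ 2 + 6 := by
  have hS := souplet (by linarith) hpq h6 h x
  have hB := (gs_bounds hn hp hpq h6 h).1
  have hU1' := gs_U_le_one h x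
  obtain ⟨hU, hV, hU0, hV0, eU, eV, rU, rV, tU, tV, hU1⟩ := h
  have hv := hV0 x
  have hu := hU0 x
  rcases le_total 1 p with h1 | h1
  · have hu1 : U x ^ (q - 1) ≤ 1 := Real.rpow_le_one hu.le hU1' (by linarith)
    have hv1 : V x ^ (p - 1) ≤ 4 * (n : ℝ) ^ 2 + 1 := by
      have hVx : V x ≤ 4 * (n : ℝ) ^ 2 + 1 := (rV 0 x (by simp)).trans hB
      calc V x ^ (p - 1) ≤ (4 * (n : ℝ) ^ 2 + 1) ^ (p - 1) :=
            Real.rpow_le_rpow hv.le hVx (by linarith)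
        _ ≤ (4 * (n : ℝ) ^ 2 + 1) ^ (1 : ℝ) :=
            Real.rpow_le_rpow_of_exponent_le (by nlinarith) (by linarith)
        _ = _ := Real.rpow_one _
    have := mul_le_mul hv1 hu1 (by positivity) (by positivity)
    linarith
  · obtain ⟨s, hs⟩ : ∃ s, s = (1 - p) / (p + 1) := ⟨_, rfl⟩
    have hs0 : 0 ≤ s := by rw [hs]; exact div_nonneg (by linarith) (by linarith)
    have hs1 : s ≤ 1 := by rw [hs, div_le_one (by linarith)]; linarith
    have hsp : (p + 1) * s = 1 - p := by rw [hs]; field_simp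
    have hsq : (q + 1) * s ≤ q - 1 := by
      rw [hs, ← mul_div_assoc, div_le_iff₀ (by linarith)]; linarith
    have h2 : (U x ^ (q + 1)) ^ s ≤ (6 * V x ^ (p + 1)) ^ s := Real.rpow_le_rpow (by positivity) hS hs0
    rw [Real.mul_rpow (by norm_num) (by positivity), ← Real.rpow_mul hu.le, ← Real.rpow_mul hv.le, hsp] at h2
    have h3 : U x ^ (q - 1) ≤ U x ^ ((q + 1) * s) := Real.rpow_le_rpow_of_exponent_ge hu hU1' hsq
    have h4 : (6 : ℝ) ^ s ≤ 6 := by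
      simpa using Real.rpow_le_rpow_of_exponent_le (show (1 : ℝ) ≤ 6 by norm_num) hs1
    have h5 : 0 < V x ^ (1 - p) := Real.rpow_pos_of_pos hv _
    have h6 : U x ^ (q - 1) ≤ 6 * V x ^ (1 - p) :=
      h3.trans (h2.trans (mul_le_mul_of_nonneg_right h4 h5.le))
    have h7 : V x ^ (p - 1) * V x ^ (1 - p) = 1 := by
      rw [← Real.rpow_add hv]; simp
    have h8 := mul_le_mul_of_nonneg_left h6 (Real.rpow_pos_of_pos hv (p - 1)).le
    nlinarith

lemma harnack (hn : 5 ≤ n) : ∃ H : ℝ, 1 ≤ H ∧ ∀ p q : ℝ, ∀ U V : 𝔼 → ℝ, 9 / 10 ≤ p → p ≤ q → q + 1 ≤ 6 * (p + 1) →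
    IsGroundState n p q U V → ∀ x w, ‖w‖ ≤ 1 → V x ≤ H * V (x + w) := by
  obtain ⟨H, hH1, hH⟩ := harnack_far n
  refine ⟨(4 * (n : ℝ) ^ 2 + 1) * 20 * H, by nlinarith [sq_nonneg (n : ℝ)], ?_⟩
  intro p q U V hp hpq h6 h x w hw
  obtain ⟨hB1, hB2⟩ := gs_bounds hn hp hpq h6 h
  obtain ⟨hU, hV, hU0, hV0, eU, eV, rU, rV, tU, tV, hU1⟩ := h
  have hHV := hH V hV hV0 rV (fun x => by
    have := eV x
    have h2 := Real.rpow_pos_of_pos (hU0 x) q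
    linarith)
  have hn2 := sq_nonneg (n : ℝ)
  have hpos := hV0 (x + w)
  rcases le_total 2 ‖x + w‖ with h2 | h2
  · have h3 := hHV x (x + w) h2 (by linarith [norm_add_le x w])
    have h4 : H ≤ (4 * (n : ℝ) ^ 2 + 1) * 20 * H := by nlinarith
    exact h3.trans (mul_le_mul_of_nonneg_right h4 hpos.le)
  · have : NeZero n := ⟨by omega⟩
    set b : 𝔼 := EuclideanSpace.single 0 1
    have hb : ‖b‖ = 1 := by simp [b]
    have hb2 : ‖(2 : ℝ) • b‖ = 2 := by rw [norm_smul, hb]; norm_num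
    have h3 := hHV b ((2 : ℝ) • b) (by rw [hb2]) (by rw [hb2, hb]; norm_num)
    have h4 := rV (x + w) ((2 : ℝ) • b) (by rw [hb2]; exact h2)
    have h5 := hB2 b hb.le
    have h6 := (rV 0 x (by simp)).trans hB1
    have h7 : 1 ≤ 20 * H * V (x + w) := by nlinarith
    nlinarith

end gs

lemma exists_abs_max {n : ℕ} {g : EuclideanSpace ℝ (Fin n) → ℝ} (hg : Continuous g)
    (h0 : Tendsto g (cocompact _) (𝓝 0)) : ∃ x, ∀ y, |g y| ≤ |g x| := by
  by_cases h : ∀ y, g y = 0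
  · exact ⟨0, fun y => by simp [h]⟩
  · push Not at h
    obtain ⟨x1, hx1⟩ := h
    have ht : Tendsto (fun y => |g y|) (cocompact _) (𝓝 0) := by simpa using h0.abs
    exact hg.abs.exists_forall_ge' x1
      ((ht.eventually (gt_mem_nhds (abs_pos.2 hx1))).mono fun y hy => le_of_lt hy)

lemma lap_bound {n : ℕ} (hn : 5 ≤ n) : ∃ a b : ℝ, 0 ≤ a ∧ 0 ≤ b ∧
      ∀ p q : ℝ, 0 < p → 0 < q →
        1 / (p + 1) + 1 / (q + 1) = ((n : ℝ) - 2) / n →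
        |p - 1| ≤ 1 / (10 * n) →
        ∀ U V : EuclideanSpace ℝ (Fin n) → ℝ, IsGroundState n p q U V →
        ∀ φ ψ : EuclideanSpace ℝ (Fin n) → ℝ,
          ContDiff ℝ 2 φ → ContDiff ℝ 2 ψ →
          (∀ x, -lap φ x = p * V x ^ (p - 1) * ψ x) →
          (∀ x, -lap ψ x = q * U x ^ (q - 1) * φ x) →
          eLpNorm (fun x => lap φ x) 2 volume = 1 →
          ∀ M : ℝ, (∀ y, |φ y| ≤ M) → ∀ x, |lap φ x| ≤ a + b * M := by
  obtain ⟨H, hH1, hH⟩ := harnack hn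
  set c := ∫ z : EuclideanSpace ℝ (Fin n), bR z with hc
  have hc0 : 0 < c := bR_int_pos
  set A := ∫ z : EuclideanSpace ℝ (Fin n), bP z with hA
  have hA0 : 0 ≤ A := bP_int_nonneg
  set D := (((∫ z : EuclideanSpace ℝ (Fin n), bR z ^ 2) + 1) / 2) with hD
  have hD0 : 0 ≤ D := by
    have : 0 ≤ ∫ z : EuclideanSpace ℝ (Fin n), bR z ^ 2 := integral_nonneg fun z => sq_nonneg _
    positivity
  set K : ℝ := 4 * (n : ℝ) ^ 2 + 6 with hK
  have hK0 : 0 ≤ K := by positivity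
  have hH0 : 0 < H := by linarith
  refine ⟨4 * H * D / c, 11 * K * H * A / c, by positivity, by positivity, ?_⟩
  intro p q hp0 hq0 hyp heps U V hgs φ ψ hφ hψ eφ eψ hL M hM x
  obtain ⟨hp1, hp2, hq11, hq1, hpq, h6, hex⟩ := params hn hp0 hq0 hyp heps
  have hHar := hH p q U V hp1 hpq h6 hgs
  have hUV := gs_UV hn hp1 hp2 hpq hq1 h6 hex hgs
  obtain ⟨hU, hV, hU0, hV0, -⟩ := hgs
  have hM0 : 0 ≤ M := (abs_nonneg _).trans (hM 0)
  have hv := hV0 x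
  have hs : |p - 1| ≤ 1 := by rw [abs_le]; constructor <;> linarith
  have hs' : |1 - p| ≤ 1 := by rw [abs_sub_comm]; exact hs
  have hHar2 : ∀ w, ‖w‖ ≤ 1 → V (x + w) ≤ H * V x := fun w hw => by
    have := hHar (x + w) (-w) (by rwa [norm_neg])
    simpa using this
  set W := V x ^ (1 - p) with hW
  have hW0 : 0 < W := Real.rpow_pos_of_pos hv _
  have hWinv : V x ^ (p - 1) * W = 1 := by rw [hW, ← Real.rpow_add hv]; simp
  -- bound on lap ψ near x
  have hlapψ : ∀ w, ‖w‖ ≤ 1 → |lap ψ (x + w)| ≤ 11 * (H * K * W) * M := by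
    intro w hw
    have hu := hU0 (x + w)
    have hu' : 0 < U (x + w) ^ (q - 1) := Real.rpow_pos_of_pos hu _
    have h1 : V x ^ (p - 1) ≤ H * V (x + w) ^ (p - 1) :=
      ratio_pow hv (hV0 _) hH1 (hHar x w hw) (hHar2 w hw) hs
    have h2 : U (x + w) ^ (q - 1) ≤ H * K * W := by
      have h3 : V x ^ (p - 1) * U (x + w) ^ (q - 1) ≤ H * K := by
        calc V x ^ (p - 1) * U (x + w) ^ (q - 1)
            ≤ H * V (x + w) ^ (p - 1) * U (x + w) ^ (q - 1) := mul_le_mul_of_nonneg_right h1 hu'.le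
          _ = H * (V (x + w) ^ (p - 1) * U (x + w) ^ (q - 1)) := by ring
          _ ≤ H * K := mul_le_mul_of_nonneg_left (hUV _) hH0.le
      have h4 := mul_le_mul_of_nonneg_right h3 hW0.le
      calc U (x + w) ^ (q - 1) = (V x ^ (p - 1) * W) * U (x + w) ^ (q - 1) := by rw [hWinv, one_mul]
        _ = V x ^ (p - 1) * U (x + w) ^ (q - 1) * W := by ring
        _ ≤ _ := h4
    rw [← abs_neg, eψ, abs_mul, abs_of_nonneg (by positivity)]
    refine mul_le_mul (mul_le_mul hq11 h2 hu'.le (by norm_num)) (hM _) (abs_nonneg _) (by positivity)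
  have hloc := Mn_local hψ x (r := 1) zero_le_one hlapψ
  -- bound on the mean of ψ
  have hψf : ∀ w, ‖w‖ ≤ 1 → |ψ (x + w)| ≤ 2 * H * W * |lap φ (x + w)| := by
    intro w hw
    have hvw := hV0 (x + w)
    have h1 : V (x + w) ^ (1 - p) ≤ H * W :=
      ratio_pow hvw hv hH1 (hHar2 w hw) (hHar x w hw) hs'
    have h2 : V (x + w) ^ (1 - p) * V (x + w) ^ (p - 1) = 1 := by rw [← Real.rpow_add hvw]; simp
    have h3 : |lap φ (x + w)| = p * V (x + w) ^ (p - 1) * |ψ (x + w)| := by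
      rw [← abs_neg, eφ, abs_mul, abs_of_nonneg (by positivity)]
    have h4 : V (x + w) ^ (1 - p) * |lap φ (x + w)| = p * |ψ (x + w)| := by
      rw [h3]
      calc _ = p * (V (x + w) ^ (1 - p) * V (x + w) ^ (p - 1)) * |ψ (x + w)| := by ring
        _ = _ := by rw [h2, mul_one]
    have h5 := mul_le_mul_of_nonneg_right h1 (abs_nonneg (lap φ (x + w)))
    have h6 := abs_nonneg (ψ (x + w))
    nlinarith
  have hφc := lap_continuous hφ
  have hψc := hψ.continuous
  have hmean : |Mn ψ x 1| ≤ 2 * H * W * D := by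
    have h1 := L2_bound hφc hL bR_continuous (fun z hz => bR_zero hz) x one_pos
    rw [Real.one_rpow, one_mul, ← hD] at h1
    have h2 : |Mn ψ x 1| ≤ ∫ z, (2 * H * W) * (bR z * |lap φ (x + (1 : ℝ) • z)|) := by
      show ‖∫ z, bR z * ψ (x + (1 : ℝ) • z)‖ ≤ _
      refine norm_integral_le_of_norm_le ((integ_bR
        (f := fun z => |lap φ (x + (1 : ℝ) • z)|) (by fun_prop)).const_mul _) ?_
      refine Eventually.of_forall fun z => ?_
      rcases le_or_gt 1 ‖z‖ with hz | hz
      · simp [bR_zero hz]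
      · rw [norm_mul, Real.norm_of_nonneg (bR_nonneg z), Real.norm_eq_abs, one_smul]
        have := mul_le_mul_of_nonneg_left (hψf z hz.le) (bR_nonneg z)
        linarith
    rw [integral_const_mul] at h2
    exact h2.trans (mul_le_mul_of_nonneg_left h1 (by positivity))
  have hψx : c * |ψ x| ≤ W * (2 * H * D + 11 * K * H * A * M / 2) := by
    rw [Mn_zero, ← hc, ← hA] at hloc
    have h1 : |c * ψ x| ≤ |Mn ψ x 1| + |Mn ψ x 1 - c * ψ x| := by
      have := abs_sub (Mn ψ x 1) (Mn ψ x 1 - c * ψ x)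
      rwa [sub_sub_cancel] at this
    rw [abs_mul, abs_of_pos hc0] at h1
    calc c * |ψ x| ≤ 2 * H * W * D + 11 * (H * K * W) * M * A * 1 ^ 2 / 2 := by linarith
      _ = _ := by ring
  have hfx : |lap φ x| = p * V x ^ (p - 1) * |ψ x| := by
    rw [← abs_neg, eφ, abs_mul, abs_of_nonneg (by positivity)]
  have hfin : c * |lap φ x| ≤ 2 * (2 * H * D + 11 * K * H * A * M / 2) := by
    rw [hfx]
    have hvp : 0 < V x ^ (p - 1) := Real.rpow_pos_of_pos hv _
    calc c * (p * V x ^ (p - 1) * |ψ x|) = (p * V x ^ (p - 1)) * (c * |ψ x|) := by ring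
      _ ≤ (p * V x ^ (p - 1)) * (W * (2 * H * D + 11 * K * H * A * M / 2)) :=
        mul_le_mul_of_nonneg_left hψx (by positivity)
      _ = p * (V x ^ (p - 1) * W) * (2 * H * D + 11 * K * H * A * M / 2) := by ring
      _ ≤ _ := by
        rw [hWinv, mul_one]
        exact mul_le_mul_of_nonneg_right (by linarith) (by positivity)
  have : 4 * H * D / c + 11 * K * H * A / c * M = (4 * H * D + 11 * K * H * A * M) / c := by
    field_simp
  rw [this, le_div_iff₀ hc0]
  linarith

end LE

theorem linearized_uniform_bound_near_one (n : ℕ) (hn : 5 ≤ n) :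
    ∃ ε₀ : ℝ, 0 < ε₀ ∧ ∃ C : ℝ, 0 < C ∧
      ∀ p q : ℝ, 0 < p → 0 < q →
        1 / (p + 1) + 1 / (q + 1) = ((n : ℝ) - 2) / n →
        |p - 1| ≤ ε₀ →
        ∀ U V : EuclideanSpace ℝ (Fin n) → ℝ, IsGroundState n p q U V →
        ∀ φ ψ : EuclideanSpace ℝ (Fin n) → ℝ,
          ContDiff ℝ 2 φ → ContDiff ℝ 2 ψ →
          (∀ x, -lap φ x = p * V x ^ (p - 1) * ψ x) →
          (∀ x, -lap ψ x = q * U x ^ (q - 1) * φ x) →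
          Tendsto φ (cocompact _) (nhds 0) →
          Tendsto ψ (cocompact _) (nhds 0) →
          eLpNorm (fun x => lap φ x) 2 volume = 1 →
          ∀ x, |φ x| ≤ C ∧ |lap φ x| ≤ C := by
  obtain ⟨a, b, ha, hb, hab⟩ := LE.lap_bound hn
  have hn' : (5 : ℝ) ≤ n := by exact_mod_cast hn
  set c := ∫ z : EuclideanSpace ℝ (Fin n), LE.bR z with hc
  have hc0 : 0 < c := LE.bR_int_pos
  set A := ∫ z : EuclideanSpace ℝ (Fin n), LE.bP z with hA
  have hA0 : 0 ≤ A := LE.bP_int_nonneg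
  obtain ⟨r, hr⟩ : ∃ r, r = Real.sqrt (c / (b * A + 1)) := ⟨_, rfl⟩
  have hr0 : 0 < r := by rw [hr]; exact Real.sqrt_pos.2 (by positivity)
  have hr2 : b * A * r ^ 2 ≤ c := by
    have h1 : r ^ 2 * (b * A + 1) = c := by
      rw [hr, Real.sq_sqrt (by positivity)]; field_simp
    nlinarith [sq_nonneg r]
  set E := (((∫ z : EuclideanSpace ℝ (Fin n), LE.bP z ^ 2) + 1) / 2) *
    (r ^ (2 - (n : ℝ) / 2) / ((n : ℝ) / 2 - 2)) with hE
  have hE0 : 0 ≤ E := by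
    have h1 : 0 ≤ ∫ z : EuclideanSpace ℝ (Fin n), LE.bP z ^ 2 := integral_nonneg fun z => sq_nonneg _
    have h2 : 0 < (n : ℝ) / 2 - 2 := by linarith
    positivity
  obtain ⟨B, hB⟩ : ∃ B, B = (a * A * r ^ 2 + 2 * E) / c := ⟨_, rfl⟩
  have hB0 : 0 ≤ B := by rw [hB]; positivity
  refine ⟨1 / (10 * n), by positivity, B + a + b * B + 1, by positivity, ?_⟩
  intro p q hp hq hyp heps U V hgs φ ψ hφ hψ eφ eψ tφ tψ hL
  have hlap := hab p q hp hq hyp heps U V hgs φ ψ hφ hψ eφ eψ hL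
  obtain ⟨x0, hx0⟩ := LE.exists_abs_max hφ.continuous tφ
  have hlap0 := hlap _ hx0
  have h1 := LE.Mn_local hφ x0 hr0.le (fun w _ => hlap0 (x0 + w))
  have h2 := LE.Mn_far hn hφ tφ hL x0 hr0
  rw [← hE] at h2
  rw [LE.Mn_zero, ← hc, ← hA] at h1
  have h3 : |c * φ x0| ≤ |LE.Mn φ x0 r| + |LE.Mn φ x0 r - c * φ x0| := by
    have := abs_sub (LE.Mn φ x0 r) (LE.Mn φ x0 r - c * φ x0)
    rwa [sub_sub_cancel] at this
  rw [abs_mul, abs_of_pos hc0] at h3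
  have hM : |φ x0| ≤ B := by
    rw [hB, le_div_iff₀ hc0]
    have h4 := mul_le_mul_of_nonneg_right hr2 (abs_nonneg (φ x0))
    nlinarith
  intro x
  have h5 := mul_le_mul_of_nonneg_left hM hb
  have h6 : 0 ≤ b * B := by positivity
  constructor
  · linarith [hx0 x]
  · linarith [hlap0 x]
end

section
/- Let n ≥ 5. There exist ε₀ > 0 and a constant C > 0 depending only on n and ε₀ such that for every p on the critical hyperbola with |p − 1| ≤ ε₀ and q = q(p), and for every pair (φ, ψ) of C² functions on ℝⁿ satisfying −Δφ = p V_p^{p−1} ψ and −Δψ = q U_p^{q−1} φ on ℝⁿ, with φ(x), ψ(x) → 0 as |x| → ∞ and ‖Δφ‖_{L²(ℝⁿ)} = 1, one has |φ(x)| ≤ C/(1 + |x|^{(n−4)/2}) and |Δφ(x)| ≤ C/(1 + |x|^{n/2}) for all x ∈ ℝⁿ. -/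
open Filter MeasureTheory Topology

section LapBasics
variable {n : ℕ}

lemma line_deriv1 {f : EuclideanSpace ℝ (Fin n) → ℝ} (hf : ContDiff ℝ 2 f)
    (x e : EuclideanSpace ℝ (Fin n)) (t : ℝ) :
    HasDerivAt (fun t : ℝ => f (x + t • e)) (fderiv ℝ f (x + t • e) e) t := by
  have h1 : HasFDerivAt f (fderiv ℝ f (x + t • e)) (x + t • e) :=
    (hf.differentiable (by norm_num) _).hasFDerivAt
  have h2 : HasDerivAt (fun t : ℝ => x + t • e) e t := by
    simpa using ((hasDerivAt_id t).smul_const e).const_add x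
  exact h1.comp_hasDerivAt t h2

lemma contDiff_fderiv1 {f : EuclideanSpace ℝ (Fin n) → ℝ} (hf : ContDiff ℝ 2 f) :
    ContDiff ℝ 1 (fderiv ℝ f) :=
  hf.fderiv_right (m := 1) (by norm_num)

lemma line_deriv2 {f : EuclideanSpace ℝ (Fin n) → ℝ} (hf : ContDiff ℝ 2 f)
    (x e : EuclideanSpace ℝ (Fin n)) (t : ℝ) :
    HasDerivAt (fun t : ℝ => fderiv ℝ f (x + t • e) e)
      (fderiv ℝ (fderiv ℝ f) (x + t • e) e e) t := by
  have h1 : HasFDerivAt (fderiv ℝ f) (fderiv ℝ (fderiv ℝ f) (x + t • e)) (x + t • e) :=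
    ((contDiff_fderiv1 hf).differentiable (by norm_num) _).hasFDerivAt
  have h2 : HasDerivAt (fun t : ℝ => x + t • e) e t := by
    simpa using ((hasDerivAt_id t).smul_const e).const_add x
  have h3 : HasDerivAt (fun t : ℝ => fderiv ℝ f (x + t • e))
      (fderiv ℝ (fderiv ℝ f) (x + t • e) e) t := h1.comp_hasDerivAt t h2
  simpa using h3.clm_apply (hasDerivAt_const t e)

lemma second_deriv_eq {f : EuclideanSpace ℝ (Fin n) → ℝ} (hf : ContDiff ℝ 2 f)
    (x e : EuclideanSpace ℝ (Fin n)) (g : ℝ → ℝ) (d : ℝ)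
    (h1 : ∀ t, HasDerivAt (fun t : ℝ => f (x + t • e)) (g t) t)
    (h2 : HasDerivAt g d 0) : fderiv ℝ (fderiv ℝ f) x e e = d := by
  have hg : g = fun t : ℝ => fderiv ℝ f (x + t • e) e := by
    funext t
    exact (h1 t).unique (line_deriv1 hf x e t)
  rw [hg] at h2
  have := h2.unique (line_deriv2 hf x e 0)
  simpa using this.symm

lemma second_deriv_nonneg_of_min (g g' : ℝ → ℝ) (d : ℝ) (h1 : ∀ t, HasDerivAt g (g' t) t)
    (h2 : HasDerivAt g' d 0) (hmin : IsLocalMin g 0) : 0 ≤ d := by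
  by_contra hd
  push Not at hd
  have hder : deriv g = g' := funext fun t => (h1 t).deriv
  have h0 : deriv g 0 = 0 := hmin.deriv_eq_zero
  have hdd : deriv (deriv g) 0 < 0 := by rw [hder, h2.deriv]; exact hd
  have hmax : IsLocalMax g 0 :=
    isLocalMax_of_deriv_deriv_neg hdd h0 (h1 0).continuousAt
  have hconst : g =ᶠ[𝓝 0] fun _ => g 0 := by
    filter_upwards [hmin, hmax] with t ht1 ht2
    exact le_antisymm ht2 ht1
  have h3 : deriv g =ᶠ[𝓝 0] deriv (fun _ => g 0) := hconst.deriv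
  have h4 : deriv (deriv g) 0 = 0 := by
    rw [h3.deriv_eq]; simp
  linarith

lemma lap_nonneg_of_min {f : EuclideanSpace ℝ (Fin n) → ℝ} (hf : ContDiff ℝ 2 f)
    (x : EuclideanSpace ℝ (Fin n)) (hmin : IsLocalMin f x) : 0 ≤ lap f x := by
  unfold lap
  refine Finset.sum_nonneg fun i _ => ?_
  have h2 := line_deriv2 hf x (EuclideanSpace.single i 1) 0
  have h := second_deriv_nonneg_of_min _ _ _ (line_deriv1 hf x (EuclideanSpace.single i 1)) h2 ?_
  · simpa using h
  · have hc : Continuous (fun t : ℝ => x + t • (EuclideanSpace.single i (1:ℝ))) := by fun_prop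
    have ht : Tendsto (fun t : ℝ => x + t • (EuclideanSpace.single i (1:ℝ))) (𝓝 0) (𝓝 x) := by
      simpa using hc.tendsto 0
    have := ht.eventually hmin
    filter_upwards [this] with t h
    simpa using h

lemma lap_add {f g : EuclideanSpace ℝ (Fin n) → ℝ} (hf : ContDiff ℝ 2 f) (hg : ContDiff ℝ 2 g)
    (x : EuclideanSpace ℝ (Fin n)) : lap (fun y => f y + g y) x = lap f x + lap g x := by
  unfold lap
  rw [← Finset.sum_add_distrib]
  refine Finset.sum_congr rfl fun i _ => ?_
  refine second_deriv_eq (hf.add hg) x _ _ _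
    (fun t => (line_deriv1 hf x _ t).add (line_deriv1 hg x _ t)) ?_
  simpa using (line_deriv2 hf x (EuclideanSpace.single i 1) 0).fun_add
    (line_deriv2 hg x (EuclideanSpace.single i 1) 0)

lemma lap_const_mul {f : EuclideanSpace ℝ (Fin n) → ℝ} (hf : ContDiff ℝ 2 f) (c : ℝ)
    (x : EuclideanSpace ℝ (Fin n)) : lap (fun y => c * f y) x = c * lap f x := by
  unfold lap
  rw [Finset.mul_sum]
  refine Finset.sum_congr rfl fun i _ => ?_
  refine second_deriv_eq (contDiff_const.mul hf) x _ _ _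
    (fun t => (line_deriv1 hf x _ t).const_mul c) ?_
  simpa using (line_deriv2 hf x (EuclideanSpace.single i 1) 0).const_mul c

lemma normsq_line (x : EuclideanSpace ℝ (Fin n)) (i : Fin n) (t : ℝ) :
    ‖x + t • (EuclideanSpace.single i (1:ℝ))‖ ^ 2 = ‖x‖ ^ 2 + 2 * x i * t + t ^ 2 := by
  rw [norm_add_sq_real, inner_smul_right, EuclideanSpace.inner_single_right, norm_smul]
  simp
  ring

lemma lap_normsq (x : EuclideanSpace ℝ (Fin n)) :
    lap (fun y : EuclideanSpace ℝ (Fin n) => ‖y‖ ^ 2) x = 2 * n := by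
  have h : ∀ i : Fin n, fderiv ℝ (fderiv ℝ (fun y : EuclideanSpace ℝ (Fin n) => ‖y‖ ^ 2)) x
      (EuclideanSpace.single i 1) (EuclideanSpace.single i 1) = 2 := by
    intro i
    refine second_deriv_eq (contDiff_norm_sq ℝ) x _ (fun t => 2 * x i + 2 * t) _ ?_ ?_
    · intro t
      simp only [normsq_line]
      have := (((hasDerivAt_id t).const_mul (2 * x i)).const_add (‖x‖ ^ 2)).fun_add (hasDerivAt_pow 2 t)
      simpa using this
    · simpa using ((hasDerivAt_id (0:ℝ)).const_mul 2).const_add (2 * x i)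
  unfold lap
  simp [h, mul_comm]

lemma contDiff_gauss (α : ℝ) :
    ContDiff ℝ 2 (fun y : EuclideanSpace ℝ (Fin n) => Real.exp (-α * ‖y‖ ^ 2)) :=
  Real.contDiff_exp.comp (contDiff_const.mul (contDiff_norm_sq ℝ))

lemma lap_gauss (α : ℝ) (x : EuclideanSpace ℝ (Fin n)) :
    lap (fun y : EuclideanSpace ℝ (Fin n) => Real.exp (-α * ‖y‖ ^ 2)) x
      = (4 * α ^ 2 * ‖x‖ ^ 2 - 2 * n * α) * Real.exp (-α * ‖x‖ ^ 2) := by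
  have h : ∀ i : Fin n, fderiv ℝ (fderiv ℝ (fun y : EuclideanSpace ℝ (Fin n) =>
      Real.exp (-α * ‖y‖ ^ 2))) x
      (EuclideanSpace.single i 1) (EuclideanSpace.single i 1)
        = (4 * α ^ 2 * (x i) ^ 2 - 2 * α) * Real.exp (-α * ‖x‖ ^ 2) := by
    intro i
    have hq : ∀ t : ℝ, HasDerivAt (fun t : ℝ => -α * (‖x‖ ^ 2 + 2 * x i * t + t ^ 2))
        (-α * (2 * x i + 2 * t)) t := by
      intro t
      have := ((((hasDerivAt_id t).const_mul (2 * x i)).const_add (‖x‖ ^ 2)).fun_add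
        (hasDerivAt_pow 2 t)).const_mul (-α)
      simpa using this
    refine second_deriv_eq (contDiff_gauss α) x _
      (fun t => Real.exp (-α * (‖x‖ ^ 2 + 2 * x i * t + t ^ 2)) * (-α * (2 * x i + 2 * t))) _ ?_ ?_
    · intro t
      have := (hq t).exp
      simpa only [normsq_line] using this
    · have h1 : HasDerivAt (fun t : ℝ => -α * (2 * x i + 2 * t)) (-α * (2 * 1)) 0 :=
        ((((hasDerivAt_id (0:ℝ)).const_mul 2).const_add (2 * x i))).const_mul (-α)
      have h2 := ((hq 0).exp).mul h1
      have hd : (4 * α ^ 2 * x i ^ 2 - 2 * α) * Real.exp (-α * ‖x‖ ^ 2) =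
          Real.exp (-α * (‖x‖ ^ 2 + 2 * x i * 0 + 0 ^ 2)) * (-α * (2 * x i + 2 * 0)) *
            (-α * (2 * x i + 2 * 0)) +
          Real.exp (-α * (‖x‖ ^ 2 + 2 * x i * 0 + 0 ^ 2)) * (-α * (2 * 1)) := by
        simp
        ring
      rw [hd]
      exact h2
  unfold lap
  simp only [h]
  rw [← Finset.sum_mul, Finset.sum_sub_distrib, ← Finset.mul_sum, ← EuclideanSpace.real_norm_sq_eq]
  simp
  ring_nf

lemma continuous_lap {f : EuclideanSpace ℝ (Fin n) → ℝ} (hf : ContDiff ℝ 2 f) :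
    Continuous (lap f) := by
  unfold lap
  have h : Continuous (fderiv ℝ (fderiv ℝ f)) := (contDiff_fderiv1 hf).continuous_fderiv (by norm_num)
  fun_prop

/-- Comparison with a paraboloid on a ball. -/
lemma ball_compare {f : EuclideanSpace ℝ (Fin n) → ℝ} (hf : ContDiff ℝ 2 f) (hn : 0 < n)
    (R b s : ℝ) (hlap : ∀ x, ‖x‖ < R → lap f x < -s)
    (hb : ∀ x, ‖x‖ = R → b ≤ f x) (x : EuclideanSpace ℝ (Fin n)) (hx : ‖x‖ ≤ R) :
    b + s * (R ^ 2 - ‖x‖ ^ 2) / (2 * n) ≤ f x := by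
  have hn' : (0:ℝ) < n := by exact_mod_cast hn
  set g : EuclideanSpace ℝ (Fin n) → ℝ := fun y => f y + (s / (2 * n)) * ‖y‖ ^ 2 with hg
  have hns : ContDiff ℝ 2 (fun y : EuclideanSpace ℝ (Fin n) => ‖y‖ ^ 2) := contDiff_norm_sq ℝ
  have hgc : ContDiff ℝ 2 g := hf.add (contDiff_const.mul hns)
  obtain ⟨x₀, hx₀, hmin⟩ := (isCompact_closedBall (0 : EuclideanSpace ℝ (Fin n)) R).exists_isMinOn
    ⟨x, by simpa using hx⟩ hgc.continuous.continuousOn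
  have hx₀' : ‖x₀‖ ≤ R := by simpa using hx₀
  have hxm : g x₀ ≤ g x := hmin (by simpa using hx)
  rcases hx₀'.lt_or_eq with hlt | heq
  · exfalso
    have hloc : IsLocalMin g x₀ := by
      refine hmin.isLocalMin ?_
      exact Filter.mem_of_superset (Metric.isOpen_ball.mem_nhds (by simpa using hlt))
        Metric.ball_subset_closedBall
    have h1 := lap_nonneg_of_min hgc x₀ hloc
    have h2 : lap g x₀ = lap f x₀ + (s / (2 * n)) * (2 * n) := by
      rw [hg, lap_add hf (contDiff_const.mul hns), lap_const_mul hns, lap_normsq]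
    have h3 := hlap x₀ hlt
    have h4 : s / (2 * n) * (2 * n) = s := by field_simp
    linarith
  · have h1 := hb x₀ heq
    have h2 : f x₀ + (s / (2 * n)) * R ^ 2 ≤ f x + (s / (2 * n)) * ‖x‖ ^ 2 := by
      rw [← heq]; exact hxm
    have h3 : s * (R ^ 2 - ‖x‖ ^ 2) / (2 * n) = (s / (2 * n)) * R ^ 2 - (s / (2 * n)) * ‖x‖ ^ 2 := by
      ring
    linarith

/-- Comparison with a Gaussian outside a ball. -/
lemma ext_compare {f : EuclideanSpace ℝ (Fin n) → ℝ} (hf : ContDiff ℝ 2 f) (hn : 0 < n)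
    (r b : ℝ) (hr : 0 < r) (hb0 : 0 ≤ b) (hlap : ∀ x, lap f x < 0)
    (htend : Tendsto f (cocompact _) (𝓝 0))
    (hb : ∀ x, ‖x‖ = r → b ≤ f x) (x : EuclideanSpace ℝ (Fin n)) (hx : r ≤ ‖x‖) :
    b * Real.exp (-(n / 2) * (‖x‖ ^ 2 / r ^ 2 - 1)) ≤ f x := by
  have hn' : (0:ℝ) < n := by exact_mod_cast hn
  set α : ℝ := n / (2 * r ^ 2) with hα
  have hα0 : 0 < α := by positivity
  set c : ℝ := b * Real.exp (n / 2) with hc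
  have hc0 : 0 ≤ c := by positivity
  set G : EuclideanSpace ℝ (Fin n) → ℝ := fun y => Real.exp (-α * ‖y‖ ^ 2) with hG
  have hGc : ContDiff ℝ 2 G := contDiff_gauss α
  set g : EuclideanSpace ℝ (Fin n) → ℝ := fun y => f y + (-c) * G y with hg
  have hgc : ContDiff ℝ 2 g := hf.add (contDiff_const.mul hGc)
  have hlapg : ∀ y, r ≤ ‖y‖ → lap g y < 0 := by
    intro y hy
    rw [hg, lap_add hf (contDiff_const.mul hGc), lap_const_mul hGc, hG, lap_gauss]
    have h1 : 0 ≤ 4 * α ^ 2 * ‖y‖ ^ 2 - 2 * n * α := by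
      have : 4 * α ^ 2 * ‖y‖ ^ 2 - 2 * n * α = 4 * α * (α * ‖y‖ ^ 2 - n / 2) := by ring
      rw [this]
      have h3 : α * r ^ 2 = n / 2 := by rw [hα]; field_simp
      have h4 : r ^ 2 ≤ ‖y‖ ^ 2 := by gcongr
      have h5 : α * r ^ 2 ≤ α * ‖y‖ ^ 2 := by gcongr
      have : 0 ≤ α * ‖y‖ ^ 2 - n / 2 := by linarith
      positivity
    have h2 : 0 ≤ c * ((4 * α ^ 2 * ‖y‖ ^ 2 - 2 * n * α) * Real.exp (-α * ‖y‖ ^ 2)) := by positivity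
    have := hlap y
    linarith
  have hgb : ∀ y, ‖y‖ = r → 0 ≤ g y := by
    intro y hy
    have h3 : c * G y = b := by
      simp only [hc, hG, hy, mul_assoc, ← Real.exp_add]
      have : (n:ℝ) / 2 + -α * r ^ 2 = 0 := by rw [hα]; field_simp; ring
      rw [this]; simp
    have := hb y hy
    simp only [hg]
    linarith
  have hgt : Tendsto g (cocompact _) (𝓝 0) := by
    have h1 : Tendsto G (cocompact _) (𝓝 0) := by
      have h2 : Tendsto (fun y : EuclideanSpace ℝ (Fin n) => ‖y‖ ^ 2) (cocompact _) atTop :=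
        (tendsto_pow_atTop (by norm_num)).comp tendsto_norm_cocompact_atTop
      exact Real.tendsto_exp_atBot.comp (h2.const_mul_atTop_of_neg (by linarith))
    have h2 := htend.add (h1.const_mul (-c))
    rw [mul_zero, add_zero] at h2
    exact h2
  have key : 0 ≤ g x := by
    by_contra hneg
    push Not at hneg
    have hev : ∀ᶠ y in cocompact (EuclideanSpace ℝ (Fin n)), g x < g y :=
      hgt.eventually (lt_mem_nhds hneg)
    have hcl : IsClosed {y : EuclideanSpace ℝ (Fin n) | r ≤ ‖y‖} :=
      isClosed_le continuous_const continuous_norm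
    obtain ⟨x₀, hx₀, hmin⟩ := hgc.continuous.continuousOn.exists_isMinOn' hcl hx
      ((hev.filter_mono inf_le_left).mono fun y hy => hy.le)
    have hle : g x₀ ≤ g x := hmin hx
    have hne : ‖x₀‖ ≠ r := fun h => by linarith [hgb x₀ h]
    have hlt : r < ‖x₀‖ := lt_of_le_of_ne hx₀ (Ne.symm hne)
    have hloc : IsLocalMin g x₀ := by
      refine hmin.isLocalMin ?_
      exact Filter.mem_of_superset ((isOpen_lt continuous_const continuous_norm).mem_nhds hlt)
        (fun y (hy : r < ‖y‖) => hy.le)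
    linarith [lap_nonneg_of_min hgc x₀ hloc, hlapg x₀ hx₀]
  have h3 : c * G x = b * Real.exp (-(n / 2) * (‖x‖ ^ 2 / r ^ 2 - 1)) := by
    simp only [hc, hG, mul_assoc, ← Real.exp_add]
    congr 2
    rw [hα]; field_simp; ring
  simp only [hg] at key
  linarith

end LapBasics

section Averages
variable {n : ℕ}

/-- The averaging profile. -/
noncomputable def avT {n : ℕ} (z : EuclideanSpace ℝ (Fin n)) : ℝ := max (1 - ‖z‖ ^ 2) 0

/-- The potential of the averaging profile: its gradient is `-avT z • z`. -/
noncomputable def avP {n : ℕ} (z : EuclideanSpace ℝ (Fin n)) : ℝ := (avT z) ^ 2 / 4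

lemma avT_nonneg (z : EuclideanSpace ℝ (Fin n)) : 0 ≤ avT z := le_max_right _ _

lemma avT_le_one (z : EuclideanSpace ℝ (Fin n)) : avT z ≤ 1 := by
  unfold avT
  exact max_le (by nlinarith [sq_nonneg ‖z‖]) zero_le_one

lemma avT_zero_of (z : EuclideanSpace ℝ (Fin n)) (hz : 1 ≤ ‖z‖) : avT z = 0 := by
  unfold avT
  exact max_eq_right (by nlinarith)

lemma continuous_avT : Continuous (avT : EuclideanSpace ℝ (Fin n) → ℝ) := by
  unfold avT
  fun_prop

lemma continuous_avP : Continuous (avP : EuclideanSpace ℝ (Fin n) → ℝ) := by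
  unfold avP
  exact (continuous_avT.pow 2).div_const 4

lemma avP_nonneg (z : EuclideanSpace ℝ (Fin n)) : 0 ≤ avP z := by unfold avP; positivity

lemma avP_le (z : EuclideanSpace ℝ (Fin n)) : avP z ≤ avT z := by
  unfold avP
  nlinarith [avT_nonneg z, avT_le_one z]

lemma hcs_avT : HasCompactSupport (avT : EuclideanSpace ℝ (Fin n) → ℝ) := by
  refine HasCompactSupport.intro (isCompact_closedBall 0 1) fun z hz => avT_zero_of z ?_
  simp at hz
  exact hz.le

lemma hcs_avP : HasCompactSupport (avP : EuclideanSpace ℝ (Fin n) → ℝ) := by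
  refine HasCompactSupport.intro (isCompact_closedBall 0 1) fun z hz => ?_
  simp at hz
  simp [avP, avT_zero_of z hz.le]

lemma hasDerivAt_max_sq (t : ℝ) : HasDerivAt (fun t : ℝ => (max t 0) ^ 2) (2 * max t 0) t := by
  rcases lt_trichotomy t 0 with h | h | h
  · have : (fun t : ℝ => (max t 0) ^ 2) =ᶠ[𝓝 t] fun _ => 0 := by
      filter_upwards [gt_mem_nhds h] with s hs
      simp [max_eq_right hs.le]
    rw [max_eq_right h.le, mul_zero]
    exact (hasDerivAt_const t (0:ℝ)).congr_of_eventuallyEq this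
  · subst h
    simp only [max_self, mul_zero]
    rw [hasDerivAt_iff_isLittleO]
    simp only [max_self, sub_zero, smul_zero]
    have h1 : (fun t : ℝ => t ^ 2) =o[𝓝 0] fun t => t := by
      simpa using Asymptotics.isLittleO_pow_id (𝕜 := ℝ) (n := 2) (by norm_num)
    refine Asymptotics.IsBigO.trans_isLittleO (Asymptotics.IsBigO.of_bound 1 ?_) h1
    filter_upwards with s
    rcases le_total s 0 with h | h
    · simp [max_eq_right h]; positivity
    · simp [max_eq_left h]
  · have : (fun t : ℝ => (max t 0) ^ 2) =ᶠ[𝓝 t] fun t => t ^ 2 := by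
      filter_upwards [lt_mem_nhds h] with s hs
      simp [max_eq_left hs.le]
    rw [max_eq_left h.le]
    refine HasDerivAt.congr_of_eventuallyEq ?_ this
    simpa using hasDerivAt_pow 2 t

lemma hasFDerivAt_avP (z : EuclideanSpace ℝ (Fin n)) :
    HasFDerivAt (avP : EuclideanSpace ℝ (Fin n) → ℝ) ((-avT z) • innerSL ℝ z) z := by
  have h1 : HasFDerivAt (fun y : EuclideanSpace ℝ (Fin n) => 1 - ‖y‖ ^ 2)
      (-(2 • (innerSL ℝ z))) z := (hasStrictFDerivAt_norm_sq z).hasFDerivAt.const_sub 1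
  have h2 := (hasDerivAt_max_sq (1 - ‖z‖ ^ 2)).comp_hasFDerivAt z h1
  have h3 := h2.const_mul (1 / 4)
  have e1 : (avP : EuclideanSpace ℝ (Fin n) → ℝ) = fun y =>
      1 / 4 * ((fun t : ℝ => max t 0 ^ 2) ∘ fun y : EuclideanSpace ℝ (Fin n) => 1 - ‖y‖ ^ 2) y := by
    funext y; simp [avP, avT]; ring
  have e2 : (-avT z) • innerSL ℝ z = (1 / 4 : ℝ) • (2 * max (1 - ‖z‖ ^ 2) 0) •
      (-(2 • (innerSL ℝ z))) := by
    ext v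
    simp [avT]
    ring
  rw [e1, e2]
  exact h3

lemma fderiv_avP_single (z : EuclideanSpace ℝ (Fin n)) (i : Fin n) :
    fderiv ℝ avP z (EuclideanSpace.single i 1) = -(avT z * z i) := by
  rw [(hasFDerivAt_avP z).fderiv]
  simp [EuclideanSpace.inner_single_right]

/-- integrability of compactly supported products -/
lemma integrable_avT_mul {g : EuclideanSpace ℝ (Fin n) → ℝ} (hg : Continuous g) :
    Integrable (fun z => avT z * g z) volume :=
  (continuous_avT.mul hg).integrable_of_hasCompactSupport hcs_avT.mul_right

lemma integrable_avP_mul {g : EuclideanSpace ℝ (Fin n) → ℝ} (hg : Continuous g) :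
    Integrable (fun z => avP z * g z) volume :=
  (continuous_avP.mul hg).integrable_of_hasCompactSupport hcs_avP.mul_right

lemma av_ibp {f : EuclideanSpace ℝ (Fin n) → ℝ} (hf : ContDiff ℝ 2 f)
    (x : EuclideanSpace ℝ (Fin n)) (r : ℝ) :
    ∫ z, avT z * fderiv ℝ f (x + r • z) z = r * ∫ z, avP z * lap f (x + r • z) := by
  have hc1 : Continuous (fderiv ℝ f) := (contDiff_fderiv1 hf).continuous
  have hc2 : Continuous (fderiv ℝ (fderiv ℝ f)) :=
    (contDiff_fderiv1 hf).continuous_fderiv (by norm_num)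
  set e : Fin n → EuclideanSpace ℝ (Fin n) := fun i => EuclideanSpace.single i 1 with he
  have hgd : ∀ i z, HasFDerivAt (fun z => fderiv ℝ f (x + r • z) (e i))
      (((fderiv ℝ (fderiv ℝ f) (x + r • z)).comp
        (r • ContinuousLinearMap.id ℝ (EuclideanSpace ℝ (Fin n)))).flip (e i)) z := by
    intro i z
    have h1 : HasFDerivAt (fderiv ℝ f) (fderiv ℝ (fderiv ℝ f) (x + r • z)) (x + r • z) :=
      ((contDiff_fderiv1 hf).differentiable (by norm_num) _).hasFDerivAt
    have h2 : HasFDerivAt (fun z : EuclideanSpace ℝ (Fin n) => x + r • z)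
        (r • ContinuousLinearMap.id ℝ (EuclideanSpace ℝ (Fin n))) z :=
      ((hasFDerivAt_id z).const_smul r).const_add x
    have h3 : HasFDerivAt (fun z => fderiv ℝ f (x + r • z)) _ z := h1.comp z h2
    have h4 := h3.clm_apply (hasFDerivAt_const (e i) z)
    simpa using h4
  have hge : ∀ i z, fderiv ℝ (fun z => fderiv ℝ f (x + r • z) (e i)) z (e i)
      = r * fderiv ℝ (fderiv ℝ f) (x + r • z) (e i) (e i) := by
    intro i z
    rw [(hgd i z).fderiv]
    simp
  have hI1 : ∀ i, Integrable (fun z => avT z * (z i * fderiv ℝ f (x + r • z) (e i))) volume := by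
    intro i
    refine integrable_avT_mul ?_
    fun_prop
  have hI2 : ∀ i, Integrable (fun z => avP z * (r * fderiv ℝ (fderiv ℝ f) (x + r • z) (e i) (e i)))
      volume := by
    intro i
    refine integrable_avP_mul ?_
    fun_prop
  have hparts : ∀ i, ∫ z, avP z * (r * fderiv ℝ (fderiv ℝ f) (x + r • z) (e i) (e i))
      = ∫ z, avT z * (z i * fderiv ℝ f (x + r • z) (e i)) := by
    intro i
    have h := integral_mul_fderiv_eq_neg_fderiv_mul_of_integrable (μ := volume)
      (f := (avP : EuclideanSpace ℝ (Fin n) → ℝ))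
      (g := fun z => fderiv ℝ f (x + r • z) (e i)) (v := e i) ?_ ?_ ?_ ?_ ?_
    · simp only [hge] at h
      rw [h, ← integral_neg]
      congr 1
      funext z
      rw [fderiv_avP_single]
      ring
    · have := (hI1 i).neg
      refine this.congr (ae_of_all _ fun z => ?_)
      simp only [Pi.neg_apply]
      rw [fderiv_avP_single]
      ring
    · simp only [hge]
      exact hI2 i
    · refine integrable_avP_mul ?_
      fun_prop
    · intro z _
      exact (hasFDerivAt_avP z).differentiableAt
    · intro z _
      exact (hgd i z).differentiableAt
  calc ∫ z, avT z * fderiv ℝ f (x + r • z) z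
      = ∫ z, ∑ i, avT z * (z i * fderiv ℝ f (x + r • z) (e i)) := by
        congr 1
        funext z
        rw [← Finset.mul_sum]
        congr 1
        have hz : z = ∑ i, z i • e i := by
          ext j
          simp [he, Finset.sum_apply, Pi.single_apply]
        conv_lhs => rw [hz]
        rw [map_sum]
        simp only [map_smul, smul_eq_mul]
        rw [← hz]
    _ = ∑ i, ∫ z, avT z * (z i * fderiv ℝ f (x + r • z) (e i)) :=
        integral_finsetSum _ fun i _ => hI1 i
    _ = ∑ i, ∫ z, avP z * (r * fderiv ℝ (fderiv ℝ f) (x + r • z) (e i) (e i)) := by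
        refine Finset.sum_congr rfl fun i _ => (hparts i).symm
    _ = ∫ z, ∑ i, avP z * (r * fderiv ℝ (fderiv ℝ f) (x + r • z) (e i) (e i)) :=
        (integral_finsetSum _ fun i _ => hI2 i).symm
    _ = r * ∫ z, avP z * lap f (x + r • z) := by
        rw [← integral_const_mul]
        congr 1
        funext z
        unfold lap
        rw [← Finset.mul_sum, ← Finset.mul_sum]
        ring

/-- weighted average at scale r -/
noncomputable def avM {n : ℕ} (f : EuclideanSpace ℝ (Fin n) → ℝ) (x : EuclideanSpace ℝ (Fin n))
    (r : ℝ) : ℝ := ∫ z, avT z * f (x + r • z)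

lemma avM_deriv {f : EuclideanSpace ℝ (Fin n) → ℝ} (hf : ContDiff ℝ 2 f)
    (x : EuclideanSpace ℝ (Fin n)) (r : ℝ) :
    HasDerivAt (avM f x) (r * ∫ z, avP z * lap f (x + r • z)) r := by
  rw [← av_ibp hf]
  have hc1 : Continuous (fderiv ℝ f) := (contDiff_fderiv1 hf).continuous
  have hcf : Continuous f := hf.continuous
  obtain ⟨K, hK⟩ := (isCompact_closedBall x (|r| + 1)).exists_bound_of_continuousOn hc1.continuousOn
  have hmeas : ∀ s : ℝ, Integrable (fun z => avT z * f (x + s • z)) volume := fun s =>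
    integrable_avT_mul (by fun_prop)
  refine (hasDerivAt_integral_of_dominated_loc_of_deriv_le (s := Metric.ball r 1)
    (bound := fun z => avT z * K) (F' := fun s z => avT z * fderiv ℝ f (x + s • z) z)
    (Metric.ball_mem_nhds r one_pos) ?_ (hmeas r) ?_ ?_ ?_ ?_).2
  · filter_upwards with s
    exact (hmeas s).aestronglyMeasurable
  · have : Integrable (fun z => avT z * fderiv ℝ f (x + r • z) z) volume :=
      integrable_avT_mul (by fun_prop)
    exact this.aestronglyMeasurable
  · refine ae_of_all _ fun z s hs => ?_
    rw [norm_mul, Real.norm_of_nonneg (avT_nonneg z)]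
    rcases le_total 1 ‖z‖ with hz | hz
    · simp [avT_zero_of z hz]
    · refine mul_le_mul_of_nonneg_left ?_ (avT_nonneg z)
      have hs' : |s| ≤ |r| + 1 := by
        have h1 : |s - r| < 1 := by simpa [Real.dist_eq] using hs
        have h2 : |s| ≤ |s - r| + |r| := by simpa using abs_add_le (s - r) r
        linarith
      have hmem : x + s • z ∈ Metric.closedBall x (|r| + 1) := by
        simp only [mem_closedBall_iff_norm, add_sub_cancel_left, norm_smul, Real.norm_eq_abs]
        calc |s| * ‖z‖ ≤ |s| * 1 := by gcongr
          _ ≤ |r| + 1 := by linarith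
      have hk := hK _ hmem
      calc ‖fderiv ℝ f (x + s • z) z‖ ≤ ‖fderiv ℝ f (x + s • z)‖ * ‖z‖ :=
            ContinuousLinearMap.le_opNorm _ _
        _ ≤ K * 1 := by
            gcongr
            exact (norm_nonneg _).trans hk
        _ = K := mul_one K
  · exact integrable_avT_mul continuous_const
  · refine ae_of_all _ fun z s _ => ?_
    have := line_deriv1 hf x z s
    exact this.const_mul (avT z)

lemma avT_int_pos : 0 < ∫ z : EuclideanSpace ℝ (Fin n), avT z := by
  refine continuous_avT.integral_pos_of_hasCompactSupport_nonneg_nonzero hcs_avT avT_nonneg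
    (x := 0) ?_
  simp [avT]

lemma avM_zero (f : EuclideanSpace ℝ (Fin n) → ℝ) (x : EuclideanSpace ℝ (Fin n)) :
    avM f x 0 = (∫ z : EuclideanSpace ℝ (Fin n), avT z) * f x := by
  simp [avM, integral_mul_const]

lemma integrable_avT : Integrable (avT : EuclideanSpace ℝ (Fin n) → ℝ) volume :=
  continuous_avT.integrable_of_hasCompactSupport hcs_avT

lemma avP_int_bound {g : EuclideanSpace ℝ (Fin n) → ℝ}
    (x : EuclideanSpace ℝ (Fin n)) (r S : ℝ) (hr : 0 ≤ r)
    (hS : ∀ y, ‖y - x‖ ≤ r → |g y| ≤ S) :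
    |∫ z, avP z * g (x + r • z)| ≤ (∫ z : EuclideanSpace ℝ (Fin n), avT z) * S := by
  rw [← integral_mul_const, ← Real.norm_eq_abs]
  refine norm_integral_le_of_norm_le (integrable_avT.mul_const S) (ae_of_all _ fun z => ?_)
  rw [norm_mul, Real.norm_of_nonneg (avP_nonneg z)]
  rcases le_total 1 ‖z‖ with hz | hz
  · simp [avP, avT_zero_of z hz]
  · have h1 : |g (x + r • z)| ≤ S := by
      refine hS _ ?_
      simp only [add_sub_cancel_left, norm_smul, Real.norm_eq_abs, abs_of_nonneg hr]
      nlinarith [norm_nonneg z]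
    have : 0 ≤ S := (abs_nonneg _).trans h1
    rw [Real.norm_eq_abs]
    gcongr
    exacts [avT_nonneg z, avP_le z]

/-- near part -/
lemma avM_near {f : EuclideanSpace ℝ (Fin n) → ℝ} (hf : ContDiff ℝ 2 f)
    (x : EuclideanSpace ℝ (Fin n)) (r S : ℝ) (hr : 0 ≤ r)
    (hS : ∀ y, ‖y - x‖ ≤ r → |lap f y| ≤ S) :
    |avM f x r - avM f x 0| ≤ (∫ z : EuclideanSpace ℝ (Fin n), avT z) * S * r ^ 2 := by
  have hS0 : 0 ≤ S := (abs_nonneg _).trans (hS x (by simpa using hr))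
  set c := ∫ z : EuclideanSpace ℝ (Fin n), avT z with hc
  have hc0 : 0 < c := avT_int_pos
  have := Convex.norm_image_sub_le_of_norm_hasDerivWithin_le (f := avM f x) (s := Set.Icc 0 r)
    (C := r * (c * S)) (x := 0) (y := r)
    (fun s _ => (avM_deriv hf x s).hasDerivWithinAt) ?_ (convex_Icc 0 r) (by simp [hr]) (by simp [hr])
  · rw [Real.norm_eq_abs, Real.norm_eq_abs, sub_zero, abs_of_nonneg hr] at this
    calc _ ≤ _ := this
      _ = _ := by ring
  · intro s hs
    rw [norm_mul, Real.norm_of_nonneg hs.1]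
    have h1 := avP_int_bound x s S hs.1
      (fun y hy => hS y (hy.trans hs.2))
    rw [Real.norm_eq_abs]
    exact mul_le_mul hs.2 h1 (abs_nonneg _) hr

lemma avT_L2 {w : EuclideanSpace ℝ (Fin n) → ℝ} (hw : Continuous w)
    (hsqInt : Integrable (fun x => w x ^ 2) volume) (h1 : ∫ x, w x ^ 2 ≤ 1)
    (x : EuclideanSpace ℝ (Fin n)) (r : ℝ) (hr : 0 < r) :
    ∫ z, avT z * |w (x + r • z)| ≤
      ((∫ z : EuclideanSpace ℝ (Fin n), avT z ^ 2) + 1) * r ^ (-((n:ℝ) / 2)) := by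
  set lam : ℝ := r ^ (-((n:ℝ) / 2)) with hlam
  have hlp : 0 < lam := Real.rpow_pos_of_pos hr _
  have hll : lam ^ 2 = (r ^ n)⁻¹ := by
    rw [hlam, ← Real.rpow_natCast, ← Real.rpow_mul hr.le, ← Real.rpow_natCast r n,
      ← Real.rpow_neg hr.le]
    congr 1
    push_cast; ring
  have hi2 : Integrable (fun y => w (x + y) ^ 2) volume := hsqInt.comp_add_left x
  have hi3 : Integrable (fun z => w (x + r • z) ^ 2) volume :=
    hi2.comp_smul hr.ne'
  have hiT : Integrable (fun z : EuclideanSpace ℝ (Fin n) => avT z ^ 2) volume := by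
    simpa [pow_two] using integrable_avT_mul (n := n) continuous_avT
  have hval : ∫ z, w (x + r • z) ^ 2 = lam ^ 2 * ∫ y, w y ^ 2 := by
    have := Measure.integral_comp_smul volume (fun y => w (x + y) ^ 2) r
    rw [this, integral_add_left_eq_self (fun y => w y ^ 2) x, hll]
    simp [abs_of_pos hr]
  calc ∫ z, avT z * |w (x + r • z)|
      ≤ ∫ z, (lam * avT z ^ 2 + lam⁻¹ * w (x + r • z) ^ 2) := by
        refine integral_mono (integrable_avT_mul (by fun_prop))
          ((hiT.const_mul _).add (hi3.const_mul _)) fun z => ?_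
        simp only
        have hw2 : w (x + r • z) ^ 2 = |w (x + r • z)| ^ 2 := (sq_abs _).symm
        rw [hw2]
        set a := avT z
        set b := |w (x + r • z)|
        have ha : 0 ≤ a := avT_nonneg z
        have hb : 0 ≤ b := abs_nonneg _
        have key : lam * (lam * a ^ 2 + lam⁻¹ * b ^ 2 - a * b) ≥ 0 := by
          have : lam * (lam * a ^ 2 + lam⁻¹ * b ^ 2 - a * b)
              = (lam * a) ^ 2 + b ^ 2 - (lam * a) * b := by field_simp
          rw [this]
          nlinarith [sq_nonneg (lam * a - b), sq_nonneg (lam * a), sq_nonneg b]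
        have := nonneg_of_mul_nonneg_right key hlp
        linarith
    _ = lam * (∫ z : EuclideanSpace ℝ (Fin n), avT z ^ 2) + lam⁻¹ * (lam ^ 2 * ∫ y, w y ^ 2) := by
        rw [integral_add (hiT.const_mul _) (hi3.const_mul _), integral_const_mul,
          integral_const_mul, hval]
    _ = lam * (∫ z : EuclideanSpace ℝ (Fin n), avT z ^ 2) + lam * ∫ y, w y ^ 2 := by
        congr 1
        field_simp
    _ ≤ _ := by
        have : lam * ∫ y, w y ^ 2 ≤ lam * 1 := by gcongr
        linarith

/-- far part -/
lemma avM_far {f : EuclideanSpace ℝ (Fin n) → ℝ} (hn : 5 ≤ n) (hf : ContDiff ℝ 2 f)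
    (hsqInt : Integrable (fun x => lap f x ^ 2) volume) (h1 : ∫ x, lap f x ^ 2 ≤ 1)
    (x : EuclideanSpace ℝ (Fin n)) (r R : ℝ) (hr : 0 < r) (hR : r ≤ R) :
    |avM f x R - avM f x r| ≤
      2 * ((∫ z : EuclideanSpace ℝ (Fin n), avT z ^ 2) + 1) * r ^ (-(((n:ℝ) - 4) / 2)) := by
  set K := (∫ z : EuclideanSpace ℝ (Fin n), avT z ^ 2) + 1 with hK
  have hK0 : 0 ≤ K := by
    have : 0 ≤ ∫ z : EuclideanSpace ℝ (Fin n), avT z ^ 2 := integral_nonneg fun z => sq_nonneg _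
    linarith
  have hn' : (5:ℝ) ≤ n := by exact_mod_cast hn
  set a : ℝ := ((n:ℝ) - 4) / 2 with ha
  have ha0 : 1 / 2 ≤ a := by rw [ha]; linarith
  have hB : ∀ s : ℝ, 0 < s → HasDerivAt (fun s : ℝ => (K / a) * r ^ (-a) - (K / a) * s ^ (-a))
      (K * s ^ (-a - 1)) s := by
    intro s hs
    have h := ((Real.hasDerivAt_rpow_const (p := -a) (Or.inl hs.ne')).const_mul
      (K / a)).const_sub ((K / a) * r ^ (-a))
    have e : K * s ^ (-a - 1) = -(K / a * (-a * s ^ (-a - 1))) := by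
      have : a ≠ 0 := by linarith
      field_simp
    rw [e]
    exact h
  have hder : ∀ s, HasDerivAt (fun s => avM f x s - avM f x r)
      (s * ∫ z, avP z * lap f (x + s • z)) s := fun s => (avM_deriv hf x s).sub_const _
  have key := image_norm_le_of_norm_deriv_right_le_deriv_boundary' (a := r) (b := R)
    (f := fun s => avM f x s - avM f x r)
    (f' := fun s => s * ∫ z, avP z * lap f (x + s • z))
    (B := fun s : ℝ => (K / a) * r ^ (-a) - (K / a) * s ^ (-a)) (B' := fun s => K * s ^ (-a - 1))
    (fun s _ => (hder s).continuousAt.continuousWithinAt)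
    (fun s _ => (hder s).hasDerivWithinAt) (by simp)
    (fun s hs => (hB s (hr.trans_le hs.1)).continuousAt.continuousWithinAt)
    (fun s hs => (hB s (hr.trans_le hs.1)).hasDerivWithinAt) ?_ (Set.right_mem_Icc.2 hR)
  · rw [Real.norm_eq_abs] at key
    refine key.trans ?_
    have h3 : 0 ≤ K / a * R ^ (-a) := by
      have := hr.trans_le hR
      positivity
    have h4 : K / a ≤ 2 * K := by
      rw [div_le_iff₀ (by linarith)]
      nlinarith
    have h5 : K / a * r ^ (-a) ≤ 2 * K * r ^ (-a) := by gcongr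
    linarith
  · intro s hs
    have hs0 : 0 < s := hr.trans_le hs.1
    rw [norm_mul, Real.norm_of_nonneg hs0.le]
    have hcl := continuous_lap hf
    have h2 : ‖∫ z, avP z * lap f (x + s • z)‖ ≤ ∫ z, avT z * |lap f (x + s • z)| := by
      refine norm_integral_le_of_norm_le (integrable_avT_mul (by fun_prop)) (ae_of_all _ fun z => ?_)
      rw [norm_mul, Real.norm_of_nonneg (avP_nonneg z), Real.norm_eq_abs]
      exact mul_le_mul_of_nonneg_right (avP_le z) (abs_nonneg _)
    have h3 := avT_L2 hcl hsqInt h1 x s hs0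
    have h4 : s * (K * s ^ (-((n:ℝ) / 2))) = K * s ^ (-a - 1) := by
      have : -a - 1 = 1 + -((n:ℝ) / 2) := by rw [ha]; ring
      rw [this, Real.rpow_add hs0, Real.rpow_one]
      ring
    rw [← h4]
    exact mul_le_mul_of_nonneg_left (h2.trans h3) hs0.le

lemma avM_tendsto {f : EuclideanSpace ℝ (Fin n) → ℝ} (hn : 0 < n) (hf : Continuous f)
    (ht : Tendsto f (cocompact _) (𝓝 0)) (B : ℝ) (hB : ∀ x, |f x| ≤ B)
    (x : EuclideanSpace ℝ (Fin n)) : Tendsto (avM f x) atTop (𝓝 0) := by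
  have : Nonempty (Fin n) := ⟨⟨0, hn⟩⟩
  have h0 : (0:ℝ) = ∫ z : EuclideanSpace ℝ (Fin n), avT z * 0 := by simp
  rw [h0]
  refine tendsto_integral_filter_of_dominated_convergence (fun z => avT z * B) ?_ ?_
    (integrable_avT.mul_const B) ?_
  · filter_upwards with r
    exact (integrable_avT_mul (by fun_prop)).aestronglyMeasurable
  · filter_upwards with r
    refine ae_of_all _ fun z => ?_
    rw [norm_mul, Real.norm_of_nonneg (avT_nonneg z), Real.norm_eq_abs]
    exact mul_le_mul_of_nonneg_left (hB _) (avT_nonneg z)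
  · have hne : ∀ᵐ z : EuclideanSpace ℝ (Fin n) ∂volume, z ≠ 0 := by
      simp [ae_iff]
    filter_upwards [hne] with z hz
    refine Tendsto.const_mul _ (ht.comp ?_)
    rw [← Metric.cobounded_eq_cocompact, ← tendsto_norm_atTop_iff_cobounded]
    have h1 : Tendsto (fun r : ℝ => r * ‖z‖ - ‖x‖) atTop atTop :=
      tendsto_atTop_add_const_right _ _ (tendsto_id.atTop_mul_const (norm_pos_iff.2 hz))
    refine tendsto_atTop_mono' _ ?_ h1
    filter_upwards [eventually_ge_atTop 0] with r hr
    have h2 : ‖r • z‖ = r * ‖z‖ := by rw [norm_smul, Real.norm_of_nonneg hr]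
    have h3 : ‖r • z‖ ≤ ‖x + r • z‖ + ‖x‖ := by
      simpa using norm_sub_le (x + r • z) x
    linarith

end Averages

section Linear
variable {n : ℕ}

/-- Interior estimate for the second component, expressed through `lap φ`. -/
lemma step_one (L κ : ℝ) (hL : 0 ≤ L) (hκ : 0 < κ) :
    ∃ C₁ : ℝ, 0 < C₁ ∧ ∀ W Q φ ψ : EuclideanSpace ℝ (Fin n) → ℝ,
      (∀ x, 0 < W x) → (∀ x, 0 ≤ Q x) →
      (∀ y z, ‖z - y‖ ≤ (1 + ‖y‖) / 2 → κ * W y ≤ W z) →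
      (∀ x, W x * Q x * (1 + ‖x‖) ^ 4 ≤ L) →
      ContDiff ℝ 2 φ → ContDiff ℝ 2 ψ →
      (∀ x, -lap φ x = W x * ψ x) → (∀ x, -lap ψ x = Q x * φ x) →
      Integrable (fun x => lap φ x ^ 2) volume → ∫ x, lap φ x ^ 2 ≤ 1 →
      ∀ y S, (∀ z, ‖z - y‖ ≤ (1 + ‖y‖) / 2 → |φ z| ≤ S) →
        |lap φ y| ≤ C₁ * ((1 + ‖y‖) ^ (-2 : ℝ) * S + (1 + ‖y‖) ^ (-((n:ℝ) / 2))) := by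
  set c := ∫ z : EuclideanSpace ℝ (Fin n), avT z with hc
  have hc0 : 0 < c := avT_int_pos
  set K := (∫ z : EuclideanSpace ℝ (Fin n), avT z ^ 2) + 1 with hK
  have hK0 : 0 < K := by
    have : 0 ≤ ∫ z : EuclideanSpace ℝ (Fin n), avT z ^ 2 := integral_nonneg fun z => sq_nonneg _
    linarith
  set D : ℝ := (1 / 2 : ℝ) ^ (-((n:ℝ) / 2)) with hD
  have hD0 : 0 < D := by positivity
  refine ⟨4 * L / κ + K * D / (c * κ), by positivity, ?_⟩
  intro W Q φ ψ hW hQ hWW hWQ hφ hψ e1 e2 hsqInt h1 y S hS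
  set om := 1 + ‖y‖ with hom
  have hom0 : 0 < om := by positivity
  have hS0 : 0 ≤ S := (abs_nonneg _).trans (hS y (by simp; positivity))
  have hWy := hW y
  set r := om / 2 with hr
  have hr0 : 0 < r := by positivity
  have hlapψ : ∀ z, ‖z - y‖ ≤ r → |lap ψ z| ≤ 16 * L * S / (κ * W y * om ^ 4) := by
    intro z hz
    have hoz : om / 2 ≤ 1 + ‖z‖ := by
      have : ‖y‖ ≤ ‖z‖ + ‖z - y‖ := by
        have := norm_sub_le z (z - y); simpa using this
      rw [hr, hom] at hz
      rw [hom]; linarith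
    have h3 : |lap ψ z| = Q z * |φ z| := by
      rw [← abs_neg, e2, abs_mul, abs_of_nonneg (hQ z)]
    rw [h3, le_div_iff₀ (by positivity)]
    have h4 := hWQ z
    have h5 := hWW y z hz
    have h6 : (om / 2) ^ 4 ≤ (1 + ‖z‖) ^ 4 := by gcongr
    have h7 : om ^ 4 ≤ 16 * (1 + ‖z‖) ^ 4 := by
      have : (om / 2) ^ 4 = om ^ 4 / 16 := by ring
      linarith
    have hQz := hQ z
    have hWz := hW z
    calc Q z * |φ z| * (κ * W y * om ^ 4)
        ≤ Q z * S * (W z * (16 * (1 + ‖z‖) ^ 4)) := by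
          gcongr
          exact hS z hz
      _ = 16 * S * (W z * Q z * (1 + ‖z‖) ^ 4) := by ring
      _ ≤ 16 * S * L := by gcongr
      _ = 16 * L * S := by ring
  have hnear := avM_near hψ y r _ hr0.le hlapψ
  have hcl := continuous_lap hφ
  have hcψ := hψ.continuous
  have hav : |avM ψ y r| ≤ (K * r ^ (-((n:ℝ) / 2))) / (κ * W y) := by
    have h2 : |avM ψ y r| ≤ ∫ z, avT z * |lap φ (y + r • z)| * (κ * W y)⁻¹ := by
      rw [← Real.norm_eq_abs]
      unfold avM
      refine norm_integral_le_of_norm_le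
        ((integrable_avT_mul (by fun_prop)).mul_const _) (ae_of_all _ fun z => ?_)
      rw [norm_mul, Real.norm_of_nonneg (avT_nonneg z), Real.norm_eq_abs, mul_assoc]
      rcases le_total 1 ‖z‖ with hz | hz
      · simp [avT_zero_of z hz]
      · refine mul_le_mul_of_nonneg_left ?_ (avT_nonneg z)
        have h5 := hWW y (y + r • z) (by
          simp only [add_sub_cancel_left, norm_smul, Real.norm_of_nonneg hr0.le]
          nlinarith [norm_nonneg z])
        have h6 : |lap φ (y + r • z)| = W (y + r • z) * |ψ (y + r • z)| := by
          rw [← abs_neg, e1, abs_mul, abs_of_pos (hW _)]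
        rw [h6, ← div_eq_mul_inv, le_div_iff₀ (by positivity), mul_comm]
        gcongr
    rw [integral_mul_const] at h2
    refine h2.trans ?_
    rw [← div_eq_mul_inv]
    gcongr
    exact avT_L2 hcl hsqInt h1 y r hr0
  have hrD : r ^ (-((n:ℝ) / 2)) = D * om ^ (-((n:ℝ) / 2)) := by
    rw [hr, div_eq_mul_one_div, Real.mul_rpow hom0.le (by norm_num), mul_comm]
  rw [avM_zero, ← hc] at hnear
  have h8 : c * |ψ y| ≤ c * (16 * L * S / (κ * W y * om ^ 4)) * r ^ 2
      + (K * r ^ (-((n:ℝ) / 2))) / (κ * W y) := by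
    have : |c * ψ y| ≤ |avM ψ y r - c * ψ y| + |avM ψ y r| := by
      have := abs_sub (avM ψ y r) (avM ψ y r - c * ψ y)
      rw [sub_sub_cancel] at this
      linarith
    rw [abs_mul, abs_of_pos hc0] at this
    linarith
  have h9 : |lap φ y| = W y * |ψ y| := by
    rw [← abs_neg, e1, abs_mul, abs_of_pos hWy]
  have h10 : W y * |ψ y| ≤ W y / c * (c * (16 * L * S / (κ * W y * om ^ 4)) * r ^ 2
      + (K * r ^ (-((n:ℝ) / 2))) / (κ * W y)) := by
    have : W y * |ψ y| = W y / c * (c * |ψ y|) := by field_simp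
    rw [this]
    gcongr
  have h11 : om ^ (-2 : ℝ) = (om ^ 2)⁻¹ := by
    rw [Real.rpow_neg hom0.le]; norm_num
  rw [h9]
  refine h10.trans ?_
  rw [hrD, h11]
  set P := om ^ (-((n:ℝ) / 2)) with hP
  have hP0 : 0 < P := by positivity
  have h12 : W y / c * (c * (16 * L * S / (κ * W y * om ^ 4)) * r ^ 2 + (K * (D * P)) / (κ * W y))
      = 4 * L / κ * ((om ^ 2)⁻¹ * S) + K * D / (c * κ) * P := by
    rw [hr]; field_simp; ring
  rw [h12]
  have h13 : 0 ≤ (om ^ 2)⁻¹ * S := by positivity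
  have h14 : 0 ≤ 4 * L / κ := by positivity
  have h15 : 0 ≤ K * D / (c * κ) := by positivity
  nlinarith [mul_nonneg h14 hP0.le, mul_nonneg h15 h13]

/-- Estimate for the first component. -/
lemma step_two (hn : 5 ≤ n) :
    ∃ C₂ : ℝ, 0 < C₂ ∧ ∀ φ : EuclideanSpace ℝ (Fin n) → ℝ,
      ContDiff ℝ 2 φ → Tendsto φ (cocompact _) (𝓝 0) →
      Integrable (fun x => lap φ x ^ 2) volume → ∫ x, lap φ x ^ 2 ≤ 1 →
      (∃ B, ∀ x, |φ x| ≤ B) →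
      ∀ x r S, 0 < r → (∀ y, ‖y - x‖ ≤ r → |lap φ y| ≤ S) →
        |φ x| ≤ S * r ^ 2 + C₂ * r ^ (-(((n:ℝ) - 4) / 2)) := by
  set c := ∫ z : EuclideanSpace ℝ (Fin n), avT z with hc
  have hc0 : 0 < c := avT_int_pos
  set K := (∫ z : EuclideanSpace ℝ (Fin n), avT z ^ 2) + 1 with hK
  have hK0 : 0 < K := by
    have : 0 ≤ ∫ z : EuclideanSpace ℝ (Fin n), avT z ^ 2 := integral_nonneg fun z => sq_nonneg _
    linarith
  refine ⟨2 * K / c, by positivity, ?_⟩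
  intro φ hφ ht hsqInt h1 ⟨B, hB⟩ x r S hr hS
  have hnear := avM_near hφ x r S hr.le hS
  have hfar := avM_far hn hφ hsqInt h1 x r
  have htend := (avM_tendsto (by omega) hφ.continuous ht B hB x).abs
  rw [abs_zero] at htend
  rw [avM_zero, ← hc] at hnear
  set P := r ^ (-(((n:ℝ) - 4) / 2)) with hP
  have h2 : c * |φ x| - c * S * r ^ 2 - 2 * K * P ≤ 0 := by
    refine ge_of_tendsto htend ?_
    filter_upwards [eventually_ge_atTop r] with R hR
    have h3 := hfar R hr hR
    have h4 : |c * φ x| ≤ |avM φ x r - c * φ x| + |avM φ x R - avM φ x r| + |avM φ x R| := by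
      have e : c * φ x = avM φ x R - (avM φ x R - avM φ x r) - (avM φ x r - c * φ x) := by ring
      have e1 := abs_sub (avM φ x R - (avM φ x R - avM φ x r)) (avM φ x r - c * φ x)
      have e2 := abs_sub (avM φ x R) (avM φ x R - avM φ x r)
      rw [← e] at e1
      linarith
    rw [abs_mul, abs_of_pos hc0] at h4
    linarith
  have h5 : c * |φ x| ≤ c * (S * r ^ 2 + 2 * K / c * P) := by
    have : c * (S * r ^ 2 + 2 * K / c * P) = c * S * r ^ 2 + 2 * K * P := by field_simp
    linarith
  exact le_of_mul_le_mul_left h5 hc0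

lemma om_half {n : ℕ} (y z : EuclideanSpace ℝ (Fin n)) (h : ‖z - y‖ ≤ (1 + ‖y‖) / 2) :
    (1 + ‖y‖) / 2 ≤ 1 + ‖z‖ := by
  have : ‖y‖ ≤ ‖z‖ + ‖z - y‖ := by
    have := norm_sub_le z (z - y); simpa using this
  linarith

lemma bounded_of_tendsto {φ : EuclideanSpace ℝ (Fin n) → ℝ} (hφ : Continuous φ)
    (ht : Tendsto φ (cocompact _) (𝓝 0)) : ∃ B, ∀ x, |φ x| ≤ B := by
  have hev : ∀ᶠ x in cocompact (EuclideanSpace ℝ (Fin n)), |φ x| < 1 := by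
    have := ht.abs
    rw [abs_zero] at this
    exact this.eventually (gt_mem_nhds one_pos)
  obtain ⟨K, hK, hsub⟩ := mem_cocompact.1 hev
  obtain ⟨B, hB⟩ := hK.exists_bound_of_continuousOn hφ.continuousOn
  refine ⟨max B 1, fun x => ?_⟩
  by_cases hx : x ∈ K
  · exact (hB x hx).trans (le_max_left _ _)
  · exact (le_of_lt (hsub hx)).trans (le_max_right _ _)

lemma linear_est (hn : 5 ≤ n) (L κ : ℝ) (hL : 0 ≤ L) (hκ : 0 < κ) :
    ∃ C : ℝ, 0 < C ∧ ∀ W Q φ ψ : EuclideanSpace ℝ (Fin n) → ℝ,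
      (∀ x, 0 < W x) → (∀ x, 0 ≤ Q x) →
      (∀ y z, ‖z - y‖ ≤ (1 + ‖y‖) / 2 → κ * W y ≤ W z) →
      (∀ x, W x * Q x * (1 + ‖x‖) ^ 4 ≤ L) →
      ContDiff ℝ 2 φ → ContDiff ℝ 2 ψ →
      (∀ x, -lap φ x = W x * ψ x) → (∀ x, -lap ψ x = Q x * φ x) →
      Tendsto φ (cocompact _) (𝓝 0) →
      Integrable (fun x => lap φ x ^ 2) volume → ∫ x, lap φ x ^ 2 ≤ 1 →
      ∀ x, |φ x| ≤ C * (1 + ‖x‖) ^ (-(((n:ℝ) - 4) / 2)) ∧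
        |lap φ x| ≤ C * (1 + ‖x‖) ^ (-((n:ℝ) / 2)) := by
  obtain ⟨C₁, hC₁, H1⟩ := step_one (n := n) L κ hL hκ
  obtain ⟨C₂, hC₂, H2⟩ := step_two hn
  have hn' : (5:ℝ) ≤ n := by exact_mod_cast hn
  set a : ℝ := ((n:ℝ) - 4) / 2 with ha
  have ha0 : 0 < a := by rw [ha]; linarith
  have hna : (n:ℝ) / 2 = a + 2 := by rw [ha]; ring
  simp only [hna] at H1 ⊢
  set b : ℝ := (2:ℝ) ^ a with hb
  have hb0 : 0 < b := by positivity
  -- choice of the small parameter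
  obtain ⟨θ, hθ0, hθ1, hθ2⟩ : ∃ θ : ℝ, 0 < θ ∧ θ ≤ 1 / 2 ∧ θ ^ 2 * (C₁ * (4 * b * b)) ≤ 1 / 2 := by
    set X := C₁ * (4 * b * b) with hX
    have hX0 : 0 < X := by positivity
    refine ⟨1 / (2 + 2 * X), by positivity, ?_, ?_⟩
    · gcongr; linarith
    · rw [div_pow, one_pow, div_mul_eq_mul_div, one_mul, div_le_div_iff₀ (by positivity) (by positivity)]
      nlinarith
  set D : ℝ := θ ^ 2 * (C₁ * (2 : ℝ) ^ (a + 2)) + C₂ * θ ^ (-a) with hD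
  have hD0 : 0 < D := by positivity
  refine ⟨2 * D + C₁ * (2 * D * b + 1), by positivity, ?_⟩
  intro W Q φ ψ hW hQ hWW hWQ hφ hψ e1 e2 ht hsqInt h1
  obtain ⟨B, hB⟩ := bounded_of_tendsto hφ.continuous ht
  have Hlap := H1 W Q φ ψ hW hQ hWW hWQ hφ hψ e1 e2 hsqInt h1
  have Hphi := H2 φ hφ ht hsqInt h1 ⟨B, hB⟩
  -- absorption
  have main : ∀ R : ℝ, 1 ≤ R → ∀ x, (min (1 + ‖x‖) R) ^ a * |φ x| ≤ 2 * D := by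
    intro R hR
    set m : EuclideanSpace ℝ (Fin n) → ℝ := fun x => (min (1 + ‖x‖) R) ^ a with hm
    have hmin0 : ∀ x : EuclideanSpace ℝ (Fin n), 0 < min (1 + ‖x‖) R := fun x =>
      lt_min (by positivity) (by linarith)
    have hm0 : ∀ x, 0 < m x := fun x => Real.rpow_pos_of_pos (hmin0 x) _
    have hmle : ∀ x, m x ≤ (1 + ‖x‖) ^ a := fun x =>
      Real.rpow_le_rpow (hmin0 x).le (min_le_left _ _) ha0.le
    have hmdbl : ∀ y z, ‖z - y‖ ≤ (1 + ‖y‖) / 2 → m y ≤ b * m z := by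
      intro y z hz
      have h2 := om_half y z hz
      have h3 : min (1 + ‖y‖) R ≤ 2 * min (1 + ‖z‖) R := by
        rcases min_cases (1 + ‖z‖) R with h | h
        · rw [h.1]; exact (min_le_left _ _).trans (by linarith)
        · rw [h.1]; exact (min_le_right _ _).trans (by linarith)
      calc m y ≤ (2 * min (1 + ‖z‖) R) ^ a := Real.rpow_le_rpow (hmin0 y).le h3 ha0.le
        _ = b * m z := Real.mul_rpow (by norm_num) (hmin0 z).le
    have hbdd : BddAbove (Set.range fun x => m x * |φ x|) := by
      refine ⟨R ^ a * B, ?_⟩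
      rintro _ ⟨x, rfl⟩
      have : m x ≤ R ^ a := Real.rpow_le_rpow (hmin0 x).le (min_le_right _ _) ha0.le
      have := hB x
      simp only
      gcongr
    set A := ⨆ x, m x * |φ x| with hA
    have hAx : ∀ x, m x * |φ x| ≤ A := fun x => le_ciSup hbdd x
    have hA0 : 0 ≤ A := le_trans (mul_nonneg (hm0 0).le (abs_nonneg _)) (hAx 0)
    have hstep : ∀ x, m x * |φ x| ≤ A / 2 + D := by
      intro x
      set om := 1 + ‖x‖ with hom
      have hom1 : 1 ≤ om := by rw [hom]; linarith [norm_nonneg x]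
      have hom0 : 0 < om := by linarith
      have hmx := hm0 x
      have hl : ∀ y, ‖y - x‖ ≤ θ * om →
          |lap φ y| ≤ C₁ * (4 * b * b * A / (om ^ 2 * m x) + (2:ℝ) ^ (a + 2) * om ^ (-(a + 2))) := by
        intro y hy
        have hy' : ‖y - x‖ ≤ (1 + ‖x‖) / 2 := hy.trans (by rw [← hom]; nlinarith)
        have hoy := om_half x y hy'
        rw [← hom] at hoy
        have hmy := hm0 y
        have h4 := Hlap y (b * A / m y) (fun z hz => by
          rw [le_div_iff₀ hmy]
          calc |φ z| * m y ≤ |φ z| * (b * m z) := by gcongr; exact hmdbl y z hz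
            _ = b * (m z * |φ z|) := by ring
            _ ≤ b * A := by gcongr; exact hAx z)
        refine h4.trans ?_
        have h5 : (1 + ‖y‖) ^ (-2 : ℝ) ≤ 4 / om ^ 2 := by
          rw [Real.rpow_neg (by positivity), ← one_div, div_le_div_iff₀ (by positivity) (by positivity)]
          norm_num
          nlinarith
        have h6 : (1 + ‖y‖) ^ (-(a + 2)) ≤ (2:ℝ) ^ (a + 2) * om ^ (-(a + 2)) := by
          calc (1 + ‖y‖) ^ (-(a + 2)) ≤ (om / 2) ^ (-(a + 2)) :=
                Real.rpow_le_rpow_of_nonpos (by positivity) hoy (by linarith)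
            _ = (2:ℝ) ^ (a + 2) * om ^ (-(a + 2)) := by
                rw [Real.div_rpow hom0.le (by norm_num), Real.rpow_neg (by norm_num : (0:ℝ) ≤ 2)]
                field_simp
        have h7 : b * A / m y ≤ b * b * A / m x := by
          rw [div_le_div_iff₀ hmy hmx]
          calc b * A * m x ≤ b * A * (b * m y) := by gcongr; exact hmdbl x y hy'
            _ = _ := by ring
        have h8 : 4 * b * b * A / (om ^ 2 * m x) = 4 / om ^ 2 * (b * b * A / m x) := by
          field_simp
        rw [h8]
        gcongr
      have h9 := Hphi x (θ * om) _ (by positivity) hl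
      have h10 : (θ * om) ^ (-a) = θ ^ (-a) * om ^ (-a) := Real.mul_rpow hθ0.le hom0.le
      rw [h10] at h9
      have h11 : m x * om ^ (-a) ≤ 1 := by
        rw [Real.rpow_neg hom0.le, ← div_eq_mul_inv]
        exact div_le_one_of_le₀ (hmle x) (by positivity)
      have h12 : om ^ 2 * om ^ (-(a + 2)) = om ^ (-a) := by
        rw [← Real.rpow_natCast om 2, ← Real.rpow_add hom0]
        congr 1
        push_cast; ring
      calc m x * |φ x| ≤ m x * (C₁ * (4 * b * b * A / (om ^ 2 * m x) +
              (2:ℝ) ^ (a + 2) * om ^ (-(a + 2))) * (θ * om) ^ 2 + C₂ * (θ ^ (-a) * om ^ (-a))) := by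
            gcongr
        _ = θ ^ 2 * (C₁ * (4 * b * b)) * A + (m x * (om ^ 2 * om ^ (-(a + 2)))) *
              (θ ^ 2 * (C₁ * (2 : ℝ) ^ (a + 2))) + (m x * om ^ (-a)) * (C₂ * θ ^ (-a)) := by
            field_simp
        _ ≤ 1 / 2 * A + 1 * (θ ^ 2 * (C₁ * (2 : ℝ) ^ (a + 2))) + 1 * (C₂ * θ ^ (-a)) := by
            rw [h12]
            gcongr
        _ = A / 2 + D := by rw [hD]; ring
    have hAle : A ≤ A / 2 + D := ciSup_le hstep
    intro x
    have := hAx x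
    simp only [hm] at this
    linarith
  have hφb : ∀ x, |φ x| ≤ 2 * D * (1 + ‖x‖) ^ (-a) := by
    intro x
    have hp : 0 < 1 + ‖x‖ := by positivity
    have h3 := main (1 + ‖x‖) (by linarith [norm_nonneg x]) x
    rw [min_self] at h3
    rw [Real.rpow_neg hp.le, ← div_eq_mul_inv, le_div_iff₀ (by positivity), mul_comm]
    exact h3
  intro x
  have hp : 0 < 1 + ‖x‖ := by positivity
  constructor
  · refine (hφb x).trans ?_
    gcongr
    have : 0 < C₁ * (2 * D * b + 1) := by positivity
    linarith
  · have h4 := Hlap x (2 * D * b * (1 + ‖x‖) ^ (-a)) (fun z hz => by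
      refine (hφb z).trans ?_
      have h2 := om_half x z hz
      have h6 : (1 + ‖z‖) ^ (-a) ≤ b * (1 + ‖x‖) ^ (-a) := by
        calc (1 + ‖z‖) ^ (-a) ≤ ((1 + ‖x‖) / 2) ^ (-a) :=
              Real.rpow_le_rpow_of_nonpos (by positivity) h2 (by linarith)
          _ = b * (1 + ‖x‖) ^ (-a) := by
              rw [Real.div_rpow hp.le (by norm_num), Real.rpow_neg (by norm_num : (0:ℝ) ≤ 2)]
              field_simp
              exact hb.symm
      calc _ ≤ 2 * D * (b * (1 + ‖x‖) ^ (-a)) := by gcongr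
        _ = _ := by ring)
    have h12 : (1 + ‖x‖) ^ (-2:ℝ) * (1 + ‖x‖) ^ (-a) = (1 + ‖x‖) ^ (-(a + 2)) := by
      rw [← Real.rpow_add hp]
      congr 1
      ring
    refine h4.trans ?_
    calc _ = C₁ * (2 * D * b * ((1 + ‖x‖) ^ (-2:ℝ) * (1 + ‖x‖) ^ (-a)) +
          (1 + ‖x‖) ^ (-(a + 2))) := by ring
      _ = C₁ * (2 * D * b + 1) * (1 + ‖x‖) ^ (-(a + 2)) := by rw [h12]; ring
      _ ≤ _ := by gcongr; linarith

end Linear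

section Ground
variable {n : ℕ}

/-- Doubling for radially decreasing superharmonic functions. -/
lemma dbl (hn : 5 ≤ n) {f : EuclideanSpace ℝ (Fin n) → ℝ} (hf : ContDiff ℝ 2 f)
    (hpos : ∀ x, 0 < f x) (hlap : ∀ x, lap f x < 0) (ht : Tendsto f (cocompact _) (𝓝 0))
    (hmono : ∀ x y : EuclideanSpace ℝ (Fin n), ‖x‖ ≤ ‖y‖ → f y ≤ f x)
    (y z : EuclideanSpace ℝ (Fin n)) (hy : 0 < ‖y‖) (hz : ‖z‖ ≤ 4 * ‖y‖) :
    Real.exp (-(15 * n / 2 : ℝ)) * f y ≤ f z := by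
  have hfy := hpos y
  rcases le_total ‖z‖ ‖y‖ with h | h
  · have h1 : Real.exp (-(15 * n / 2 : ℝ)) ≤ 1 := Real.exp_le_one_iff.2 (by
      have : (0:ℝ) ≤ n := by positivity
      linarith)
    have := hmono z y h
    nlinarith
  · have h1 := ext_compare hf (by omega) ‖y‖ (f y) hy hfy.le hlap ht
      (fun x hx => hmono x y hx.le) z h
    refine le_trans ?_ h1
    rw [mul_comm]
    gcongr
    have h2 : ‖z‖ ^ 2 / ‖y‖ ^ 2 ≤ 16 := by
      rw [div_le_iff₀ (by positivity)]
      nlinarith [norm_nonneg z]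
    have hn0 : (0:ℝ) ≤ n := by positivity
    nlinarith

/-- Lower bound of one component by the other one. -/
lemma low (hn : 5 ≤ n) {f g : EuclideanSpace ℝ (Fin n) → ℝ} (s : ℝ) (hs : 0 < s)
    (hs4 : s ≤ 4 * n) (hf : ContDiff ℝ 2 f) (hg : ContDiff ℝ 2 g)
    (hfp : ∀ x, 0 < f x) (hgp : ∀ x, 0 < g x)
    (hfg : ∀ x, -lap f x = g x ^ s)
    (hgl : ∀ x, lap g x < 0) (hgt : Tendsto g (cocompact _) (𝓝 0))
    (hfm : ∀ x y : EuclideanSpace ℝ (Fin n), ‖x‖ ≤ ‖y‖ → f y ≤ f x)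
    (hgm : ∀ x y : EuclideanSpace ℝ (Fin n), ‖x‖ ≤ ‖y‖ → g y ≤ g x)
    (x : EuclideanSpace ℝ (Fin n)) :
    (Real.exp (-(15 * n / 2 : ℝ))) ^ (4 * n : ℝ) / (2 * n) * ‖x‖ ^ 2 * g x ^ s ≤ f x := by
  have hn' : (5:ℝ) ≤ n := by exact_mod_cast hn
  rcases (norm_nonneg x).eq_or_lt with h0 | h0
  · rw [← h0]
    simpa using (hfp x).le
  set d := Real.exp (-(15 * n / 2 : ℝ)) with hd
  have hd0 : 0 < d := Real.exp_pos _
  have hd1 : d ≤ 1 := Real.exp_le_one_iff.2 (by linarith)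
  have hnorm : ‖(2:ℝ) • x‖ = 2 * ‖x‖ := by rw [norm_smul]; norm_num
  have h1 := dbl hn hg hgp hgl hgt hgm x ((2:ℝ) • x) h0 (by rw [hnorm]; linarith)
  have hg2 := hgp ((2:ℝ) • x)
  have hgx := hgp x
  have h2 : d ^ (4 * n : ℝ) * g x ^ s ≤ g ((2:ℝ) • x) ^ s := by
    calc d ^ (4 * n : ℝ) * g x ^ s ≤ d ^ s * g x ^ s := by
          gcongr ?_ * _
          exact Real.rpow_le_rpow_of_exponent_ge hd0 hd1 hs4
      _ = (d * g x) ^ s := (Real.mul_rpow hd0.le hgx.le).symm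
      _ ≤ _ := by gcongr
  set G := g ((2:ℝ) • x) ^ s with hG
  have hG0 : 0 < G := Real.rpow_pos_of_pos hg2 _
  have h3 := ball_compare hf (by omega) (2 * ‖x‖) (f ((2:ℝ) • x)) (G / 2) (fun y hy => by
      have h4 : G ≤ g y ^ s := by
        have := hgm y ((2:ℝ) • x) (by rw [hnorm]; exact hy.le)
        rw [hG]; gcongr
      have := hfg y
      linarith) (fun y hy => hfm y _ (by rw [hnorm, hy])) x (by linarith)
  have h5 := hfp ((2:ℝ) • x)
  have h6 : G / 2 * ((2 * ‖x‖) ^ 2 - ‖x‖ ^ 2) / (2 * n) = 3 / 2 * (G * ‖x‖ ^ 2 / (2 * n)) := by ring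
  have h7 : 0 ≤ G * ‖x‖ ^ 2 / (2 * n) := by positivity
  calc d ^ (4 * n : ℝ) / (2 * n) * ‖x‖ ^ 2 * g x ^ s
      = (d ^ (4 * n : ℝ) * g x ^ s) * ‖x‖ ^ 2 / (2 * n) := by ring
    _ ≤ G * ‖x‖ ^ 2 / (2 * n) := by gcongr
    _ ≤ f x := by linarith

set_option maxHeartbeats 2000000 in
lemma gs_bounds (hn : 5 ≤ n) : ∃ L κ : ℝ, 0 ≤ L ∧ 0 < κ ∧ κ ≤ 1 ∧
    ∀ p q : ℝ, 1 / 2 ≤ p → p ≤ 2 → 0 < q → q ≤ 4 * n →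
    ∀ U V : EuclideanSpace ℝ (Fin n) → ℝ, IsGroundState n p q U V →
      (∀ x, V x ^ (p - 1) * U x ^ (q - 1) * (1 + ‖x‖) ^ 4 ≤ L) ∧
      (∀ y z, ‖z‖ ≤ 1 + 2 * ‖y‖ → κ * V y ≤ V z) := by
  have hn' : (5:ℝ) ≤ n := by exact_mod_cast hn
  set d := Real.exp (-(15 * n / 2 : ℝ)) with hd
  have hd0 : 0 < d := Real.exp_pos _
  have hd1 : d ≤ 1 := Real.exp_le_one_iff.2 (by linarith)
  set c : ℝ := d ^ (4 * n : ℝ) / (2 * n) with hc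
  have hc0 : 0 < c := by positivity
  set CV : ℝ := 16 * n ^ 2 + 1 with hCV
  have hCV1 : 1 ≤ CV := by rw [hCV]; nlinarith
  set u : ℝ := 1 / 2 * Real.exp (-(n / 2) * (4 * CV ^ 2 - 1)) with hu
  have hu0 : 0 < u := by positivity
  have hu1 : u ≤ 1 := by
    have : Real.exp (-(n / 2) * (4 * CV ^ 2 - 1)) ≤ 1 := Real.exp_le_one_iff.2 (by
      have : 0 ≤ 4 * CV ^ 2 - 1 := by nlinarith
      have : 0 ≤ (n / 2 : ℝ) * (4 * CV ^ 2 - 1) := by positivity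
      linarith)
    linarith
  set v : ℝ := c * u ^ (4 * n : ℝ) with hv
  have hv0 : 0 < v := by positivity
  refine ⟨16 / c ^ 2 + 16 * CV ^ 2 / (u * v), d * (v / (CV + v)), by positivity, by positivity, ?_, ?_⟩
  · have : v / (CV + v) ≤ 1 := div_le_one_of_le₀ (by linarith) (by positivity)
    have h2 : 0 ≤ v / (CV + v) := by positivity
    nlinarith
  intro p q hp1 hp2 hq0 hq4 U V ⟨hU, hV, hUp, hVp, eU, eV, mU, mV, tU, tV, hU0⟩
  have hUl : ∀ x, lap U x < 0 := fun x => by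
    have := eU x; have := Real.rpow_pos_of_pos (hVp x) p; linarith
  have hVl : ∀ x, lap V x < 0 := fun x => by
    have := eV x; have := Real.rpow_pos_of_pos (hUp x) q; linarith
  have lowU := low hn p (by linarith) (by linarith) hU hV hUp hVp eU hVl tV mU mV
  have lowV := low hn q hq0 hq4 hV hU hVp hUp eV hUl tU mV mU
  simp only [← hd, ← hc] at lowU lowV
  have hU1 : ∀ x, U x ≤ 1 := fun x => by
    rw [← hU0]; exact mU 0 x (by simp)
  set e : EuclideanSpace ℝ (Fin n) := EuclideanSpace.single ⟨0, by omega⟩ 1 with he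
  have hen : ‖e‖ = 1 := by simp [he]
  -- upper bound for V
  have hVe : V e ≤ 16 * n ^ 2 := by
    have h3 := ball_compare hU (by omega) 1 (U e) (V e ^ p / 2) (fun y hy => by
      have h4 : V e ^ p ≤ V y ^ p := by
        have := mV y e (by rw [hen]; exact hy.le)
        have := hVp e
        gcongr
      have := eU y
      have := Real.rpow_pos_of_pos (hVp e) p
      linarith) (fun y hy => mU y e (by rw [hen, hy])) 0 (by simp)
    rw [hU0] at h3
    have h5 := hUp e
    have h6 : V e ^ p ≤ 4 * n := by
      have : V e ^ p / 2 * (1 ^ 2 - ‖(0 : EuclideanSpace ℝ (Fin n))‖ ^ 2) / (2 * n)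
        = V e ^ p / (4 * n) := by simp; ring
      rw [this] at h3
      have h7 : V e ^ p / (4 * n) ≤ 1 := by linarith
      rwa [div_le_one (by positivity)] at h7
    rcases le_total (V e) 1 with h | h
    · nlinarith
    · have h7 : V e ^ (1 / 2 : ℝ) ≤ V e ^ p := Real.rpow_le_rpow_of_exponent_le h hp1
      rw [← Real.sqrt_eq_rpow] at h7
      have h8 : √(V e) ≤ 4 * n := h7.trans h6
      have h9 := (Real.sqrt_le_left (by positivity)).1 h8
      nlinarith
  have hV0 : V 0 ≤ CV := by
    have h3 := ball_compare (f := fun y => (-1) * V y) (contDiff_const.mul hV) (by omega) 1 (-V e) (-2)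
      (fun y hy => by
        rw [lap_const_mul hV]
        have := eV y
        have h4 : U y ^ q ≤ 1 := Real.rpow_le_one (hUp y).le (hU1 y) hq0.le
        linarith) (fun y hy => by
          have := mV e y (by rw [hen, hy])
          linarith) 0 (by simp)
    have : (-2 : ℝ) * (1 ^ 2 - ‖(0 : EuclideanSpace ℝ (Fin n))‖ ^ 2) / (2 * n) = - (1 / n) := by
      simp; ring
    rw [this] at h3
    have h5 : (1 / n : ℝ) ≤ 1 := by rw [div_le_one (by positivity)]; linarith
    rw [hCV]; linarith
  have hVC : ∀ x, V x ≤ CV := fun x => (mV 0 x (by simp)).trans hV0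
  have hVpC : ∀ x, V x ^ p ≤ CV ^ 2 := by
    intro x
    calc V x ^ p ≤ CV ^ p := Real.rpow_le_rpow (hVp x).le (hVC x) (by linarith)
      _ ≤ CV ^ (2 : ℝ) := Real.rpow_le_rpow_of_exponent_le hCV1 hp2
      _ = CV ^ 2 := by norm_num
  -- lower bound for U near the origin
  set r0 : ℝ := 1 / (2 * CV) with hr0
  have hr00 : 0 < r0 := by positivity
  have hr01 : r0 ≤ 1 := div_le_one_of_le₀ (by linarith) (by positivity)
  have hrn : ‖r0 • e‖ = r0 := by rw [norm_smul, hen, mul_one, Real.norm_of_nonneg hr00.le]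
  have hUr : 1 / 2 ≤ U (r0 • e) := by
    have h3 := ball_compare (f := fun y => (-1) * U y) (contDiff_const.mul hU) (by omega) r0
      (-U (r0 • e)) (-(2 * CV ^ 2))
      (fun y hy => by
        rw [lap_const_mul hU]
        have := eU y
        have h4 := hVpC y
        nlinarith) (fun y hy => by
          have := mU (r0 • e) y (by rw [hrn, hy])
          linarith) 0 (by simpa using hr00.le)
    rw [hU0] at h3
    have : (-(2 * CV ^ 2) : ℝ) * (r0 ^ 2 - ‖(0 : EuclideanSpace ℝ (Fin n))‖ ^ 2) / (2 * n)
        = - (1 / (4 * n)) := by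
      rw [hr0]; simp; field_simp; ring
    rw [this] at h3
    have h5 : (1 / (4 * n) : ℝ) ≤ 1 / 2 := by
      gcongr; linarith
    linarith
  have hUe : u ≤ U e := by
    have h3 := ext_compare hU (by omega) r0 (1 / 2) hr00 (by norm_num) hUl tU (fun x hx =>
      hUr.trans (mU x _ (by rw [hrn, hx]))) e (by rw [hen]; exact hr01)
    have h4 : ‖e‖ ^ 2 / r0 ^ 2 = 4 * CV ^ 2 := by
      rw [hen, hr0]; field_simp; ring
    rw [h4] at h3
    exact h3
  have hve : v ≤ V e := by
    have h3 := lowV e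
    rw [hen] at h3
    refine le_trans ?_ h3
    rw [hv, one_pow, mul_one]
    gcongr
    calc u ^ (4 * n : ℝ) ≤ u ^ q := Real.rpow_le_rpow_of_exponent_ge hu0 hu1 hq4
      _ ≤ U e ^ q := by gcongr
  constructor
  · intro x
    have hUx := hUp x
    have hVx := hVp x
    have hprod : V x ^ (p - 1) * U x ^ (q - 1) = (V x ^ p / U x) * (U x ^ q / V x) := by
      rw [Real.rpow_sub_one hVx.ne', Real.rpow_sub_one hUx.ne']
      field_simp
    rw [hprod]
    have hVpp : 0 < V x ^ p := Real.rpow_pos_of_pos hVx _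
    have hUqp : 0 < U x ^ q := Real.rpow_pos_of_pos hUx _
    rcases le_total 1 ‖x‖ with h | h
    · have hx0 : 0 < ‖x‖ := by linarith
      have a1 : V x ^ p / U x ≤ 1 / (c * ‖x‖ ^ 2) := by
        rw [div_le_div_iff₀ hUx (by positivity)]
        linarith [lowU x]
      have a2 : U x ^ q / V x ≤ 1 / (c * ‖x‖ ^ 2) := by
        rw [div_le_div_iff₀ hVx (by positivity)]
        linarith [lowV x]
      have a3 : (1 + ‖x‖) ^ 4 ≤ (2 * ‖x‖) ^ 4 := by gcongr; linarith
      calc (V x ^ p / U x) * (U x ^ q / V x) * (1 + ‖x‖) ^ 4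
          ≤ (1 / (c * ‖x‖ ^ 2)) * (1 / (c * ‖x‖ ^ 2)) * (2 * ‖x‖) ^ 4 := by gcongr
        _ = 16 / c ^ 2 := by field_simp; ring
        _ ≤ _ := by
          have : 0 ≤ 16 * CV ^ 2 / (u * v) := by positivity
          linarith
    · have b1 : u ≤ U x := hUe.trans (mU x e (by rw [hen]; exact h))
      have b2 : v ≤ V x := hve.trans (mV x e (by rw [hen]; exact h))
      have a1 : V x ^ p / U x ≤ CV ^ 2 / u := by
        have := hVpC x
        gcongr
      have a2 : U x ^ q / V x ≤ 1 / v := by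
        have := Real.rpow_le_one (hUp x).le (hU1 x) hq0.le
        gcongr
      have a3 : (1 + ‖x‖) ^ 4 ≤ 2 ^ 4 := by gcongr; linarith
      calc (V x ^ p / U x) * (U x ^ q / V x) * (1 + ‖x‖) ^ 4
          ≤ (CV ^ 2 / u) * (1 / v) * 2 ^ 4 := by gcongr
        _ = 16 * CV ^ 2 / (u * v) := by field_simp; ring
        _ ≤ _ := by
          have : 0 ≤ 16 / c ^ 2 := by positivity
          linarith
  · intro y z hz
    have hdV := dbl hn hV hVp hVl tV mV
    simp only [← hd] at hdV
    have hVy := hVp y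
    rcases le_total 1 ‖y‖ with h | h
    · have h1 := hdV y z (by linarith) (by linarith)
      have : v / (CV + v) ≤ 1 := div_le_one_of_le₀ (by linarith) (by positivity)
      calc d * (v / (CV + v)) * V y ≤ d * 1 * V y := by gcongr
        _ = d * V y := by ring
        _ ≤ V z := h1
    · have h1 := hdV e z (by rw [hen]; norm_num) (by rw [hen]; linarith)
      have h2 : v / (CV + v) * V y ≤ v := by
        rw [div_mul_eq_mul_div, div_le_iff₀ (by positivity)]
        have := hVC y
        rw [mul_comm]
        have h7 : v * V y ≤ v * CV := by gcongr
        have h8 : 0 ≤ v * v := by positivity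
        linarith
      calc d * (v / (CV + v)) * V y = d * (v / (CV + v) * V y) := by ring
        _ ≤ d * V e := by gcongr; exact h2.trans hve
        _ ≤ V z := h1

end Ground

lemma rpow_ratio (κ a b s : ℝ) (hκ : 0 < κ) (hκ1 : κ ≤ 1) (ha : 0 < a) (hb : 0 < b)
    (h1 : κ * a ≤ b) (h2 : κ * b ≤ a) (hs1 : -1 ≤ s) (hs2 : s ≤ 1) :
    κ * a ^ s ≤ b ^ s := by
  rcases le_total 0 s with h | h
  · calc κ * a ^ s = κ ^ (1:ℝ) * a ^ s := by rw [Real.rpow_one]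
      _ ≤ κ ^ s * a ^ s := by
        gcongr ?_ * _
        exact Real.rpow_le_rpow_of_exponent_ge hκ hκ1 hs2
      _ = (κ * a) ^ s := (Real.mul_rpow hκ.le ha.le).symm
      _ ≤ b ^ s := by gcongr
  · have h3 : a ^ s ≤ (κ * b) ^ s := Real.rpow_le_rpow_of_nonpos (by positivity) h2 h
    rw [Real.mul_rpow hκ.le hb.le] at h3
    have h4 : κ ^ s ≤ κ ^ (-1:ℝ) := Real.rpow_le_rpow_of_exponent_ge hκ hκ1 hs1
    rw [Real.rpow_neg_one] at h4
    have hbs : 0 < b ^ s := by positivity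
    calc κ * a ^ s ≤ κ * (κ⁻¹ * b ^ s) := by
          gcongr
          exact h3.trans (by gcongr)
      _ = b ^ s := by field_simp

lemma final_conv (C a t : ℝ) (hC : 0 < C) (ha : 0 ≤ a) (ht : 0 ≤ t) :
    C * (1 + t) ^ (-a) ≤ 2 * C / (1 + t ^ a) := by
  have h1 : t ^ a ≤ (1 + t) ^ a := by gcongr; linarith
  have h2 : 1 ≤ (1 + t) ^ a := Real.one_le_rpow (by linarith) ha
  rw [Real.rpow_neg (by linarith), ← div_eq_mul_inv, div_le_div_iff₀ (by positivity) (by positivity)]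
  nlinarith

theorem linearized_rough_decay_near_one (n : ℕ) (hn : 5 ≤ n) :
    ∃ ε₀ : ℝ, 0 < ε₀ ∧ ∃ C : ℝ, 0 < C ∧
      ∀ p q : ℝ, 0 < p → 0 < q →
        1 / (p + 1) + 1 / (q + 1) = ((n : ℝ) - 2) / n →
        |p - 1| ≤ ε₀ →
        ∀ U V : EuclideanSpace ℝ (Fin n) → ℝ, IsGroundState n p q U V →
        ∀ φ ψ : EuclideanSpace ℝ (Fin n) → ℝ,
          ContDiff ℝ 2 φ → ContDiff ℝ 2 ψ →
          (∀ x, -lap φ x = p * V x ^ (p - 1) * ψ x) →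
          (∀ x, -lap ψ x = q * U x ^ (q - 1) * φ x) →
          Tendsto φ (cocompact _) (nhds 0) →
          Tendsto ψ (cocompact _) (nhds 0) →
          eLpNorm (fun x => lap φ x) 2 volume = 1 →
          ∀ x, |φ x| ≤ C / (1 + ‖x‖ ^ (((n : ℝ) - 4) / 2)) ∧
            |lap φ x| ≤ C / (1 + ‖x‖ ^ ((n : ℝ) / 2)) := by
  have hn' : (5:ℝ) ≤ n := by exact_mod_cast hn
  obtain ⟨L, κ, hL, hκ, hκ1, hgs⟩ := gs_bounds hn
  obtain ⟨C, hC, hlin⟩ := linear_est hn (8 * n * L) κ (by positivity) hκ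
  refine ⟨1 / (2 * n), by positivity, 2 * C, by positivity, ?_⟩
  intro p q hp0 hq0 hpq hpe U V hgsUV φ ψ hφ hψ e1 e2 tφ _ hnorm x
  have hε : (1 / (2 * n) : ℝ) ≤ 1 / 10 := by gcongr; linarith
  obtain ⟨hpl, hpu⟩ := abs_le.1 hpe
  have hq4 : q ≤ 4 * n := by
    have h1 : 1 / (p + 1) ≤ 1 / 2 + 1 / (4 * n) := by
      have h2 : 1 / (p + 1) ≤ 1 / (2 - 1 / (2 * n)) := by
        gcongr
        · linarith
        · linarith
      have h3 : 1 / (2 - 1 / (2 * n : ℝ)) ≤ 1 / 2 + 1 / (4 * n) := by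
        rw [div_le_iff₀ (by linarith)]
        have e : (1 / (4 * n) : ℝ) = (1 / (2 * n)) / 2 := by field_simp; ring
        rw [e]
        set δ : ℝ := 1 / (2 * n)
        have : 0 < δ := by positivity
        nlinarith
      linarith
    have h4 : ((n:ℝ) - 2) / n = 1 - 2 / n := by field_simp
    have h5 : 1 / (4 * n) ≤ 1 / (q + 1) := by
      have e : (1 / (4 * n) : ℝ) = (1 / n) / 4 := by field_simp
      have e' : (2 / n : ℝ) = 2 * (1 / n) := by ring
      rw [h4, e'] at hpq
      rw [e] at h1 ⊢
      have : (1 / n : ℝ) ≤ 1 / 5 := by gcongr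
      linarith
    have h6 := (one_div_le_one_div (by positivity) (by positivity)).1 h5
    linarith
  obtain ⟨hb1, hb2⟩ := hgs p q (by linarith) (by linarith) hq0 hq4 U V hgsUV
  obtain ⟨hU, hV, hUp, hVp, -⟩ := hgsUV
  have hcl := continuous_lap hφ
  have hmem : MemLp (fun x => lap φ x) 2 volume :=
    ⟨hcl.aestronglyMeasurable, by rw [hnorm]; exact ENNReal.one_lt_top⟩
  have hsqInt : Integrable (fun x => lap φ x ^ 2) volume := hmem.integrable_sq
  have h1 : ∫ x, lap φ x ^ 2 ≤ 1 := by
    have h2 := hmem.eLpNorm_eq_integral_rpow_norm (by norm_num) (by norm_num)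
    rw [hnorm] at h2
    have h3 : (∫ a, ‖lap φ a‖ ^ (2:ENNReal).toReal) = ∫ x, lap φ x ^ 2 := by
      congr 1; funext a; simp
    rw [h3] at h2
    have h4 : 0 ≤ ∫ x, lap φ x ^ 2 := integral_nonneg fun _ => sq_nonneg _
    have h5 := h2.symm
    rw [ENNReal.ofReal_eq_one] at h5
    by_contra hlt
    push Not at hlt
    have := Real.one_lt_rpow hlt (show 0 < ((2:ENNReal).toReal)⁻¹ by norm_num)
    linarith
  have key := hlin (fun x => p * V x ^ (p - 1)) (fun x => q * U x ^ (q - 1)) φ ψ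
    (fun x => mul_pos hp0 (Real.rpow_pos_of_pos (hVp x) _))
    (fun x => (mul_pos hq0 (Real.rpow_pos_of_pos (hUp x) _)).le)
    (fun y z hz => by
      have hyz := om_half y z hz
      have hzy : ‖z‖ ≤ ‖y‖ + ‖z - y‖ := by
        have := norm_add_le y (z - y); simpa using this
      have h2 := rpow_ratio κ (V y) (V z) (p - 1) hκ hκ1 (hVp y) (hVp z)
        (hb2 y z (by linarith [norm_nonneg y])) (hb2 z y (by linarith)) (by linarith) (by linarith)
      show κ * (p * V y ^ (p - 1)) ≤ p * V z ^ (p - 1)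
      nlinarith)
    (fun x => by
      have h2 := hb1 x
      have hpos : 0 < V x ^ (p - 1) * U x ^ (q - 1) * (1 + ‖x‖) ^ 4 :=
        mul_pos (mul_pos (Real.rpow_pos_of_pos (hVp x) _) (Real.rpow_pos_of_pos (hUp x) _))
          (by positivity)
      have hpq2 : p * q ≤ 8 * n := by nlinarith
      calc p * V x ^ (p - 1) * (q * U x ^ (q - 1)) * (1 + ‖x‖) ^ 4
          = (p * q) * (V x ^ (p - 1) * U x ^ (q - 1) * (1 + ‖x‖) ^ 4) := by ring
        _ ≤ (8 * n) * L := by gcongr)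
    hφ hψ e1 e2 tφ hsqInt h1 x
  exact ⟨key.1.trans (final_conv C _ _ hC (by linarith) (norm_nonneg x)),
    key.2.trans (final_conv C _ _ hC (by linarith) (norm_nonneg x))⟩
end
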